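/- arXiv:2503.11582 — 11 statements merged into one kernel-verified Lean document; each statement's English description precedes it below -/
import Mathlib

section
/- Let n ≥ 1 and let Ω₁, Ω₂ ⊆ ℝⁿ be nonempty sets. Let N₁, N₂ ≥ 1, let u : Ω₁ → ℝ^{N₁}, v : Ω₂ → ℝ^{N₁}, ũ : Ω₁ → ℝ^{N₂}, ṽ : Ω₂ → ℝ^{N₂} be functions such that the linear span of u(Ω₁) is ℝ^{N₁}, the linear span of v(Ω₂) is ℝ^{N₁}, the linear span of ũ(Ω₁) is ℝ^{N₂}, the linear span of ṽ(Ω₂) is ℝ^{N₂}, and Σ_{α=1}^{N₁} u_α(ξ)v_α(η) = Σ_{α=1}^{N₂} ũ_α(ξ)ṽ_α(η) for all (ξ,η) ∈ Ω₁ × Ω₂. Then N₁ = N₂ and there exists an invertible matrix B ∈ GL(N₁, ℝ) such that ũ(ξ) = B·u(ξ) for all ξ ∈ Ω₁ and ṽ(η) = (Bᵀ)⁻¹·v(η) for all η ∈ Ω₂. -/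
open Matrix in
/-- If two families of pairings `u ⬝ᵥ v` and `ut ⬝ᵥ vt` agree and `vt` spans, then `ut` is a
linear function of `u`. -/
theorem exists_mulVec_eq_of_dotProduct_eq {R X Y ι κ : Type*} [CommRing R]
    [Fintype ι] [Fintype κ] {s : Set X} {t : Set Y}
    {u : X → ι → R} {v : Y → ι → R} {ut : X → κ → R} {vt : Y → κ → R}
    (hvt : Submodule.span R (vt '' t) = ⊤)
    (h : ∀ x ∈ s, ∀ y ∈ t, u x ⬝ᵥ v y = ut x ⬝ᵥ vt y) :
    ∃ B : Matrix κ ι R, ∀ x ∈ s, ut x = B *ᵥ u x := by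
  classical
  have key : ∀ w : κ → R, ∃ b : ι → R, ∀ x ∈ s, ut x ⬝ᵥ w = u x ⬝ᵥ b := by
    intro w
    have hw : w ∈ Submodule.span R (vt '' t) := hvt ▸ Submodule.mem_top
    induction hw using Submodule.span_induction with
    | mem w hw =>
      obtain ⟨y, hy, rfl⟩ := hw
      exact ⟨v y, fun x hx => (h x hx y hy).symm⟩
    | zero => exact ⟨0, fun x _ => by simp⟩
    | add w₁ w₂ _ _ h₁ h₂ =>
      obtain ⟨b₁, h₁⟩ := h₁
      obtain ⟨b₂, h₂⟩ := h₂
      exact ⟨b₁ + b₂, fun x hx => by rw [dotProduct_add, dotProduct_add, h₁ x hx, h₂ x hx]⟩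
    | smul c w _ hw =>
      obtain ⟨b, hb⟩ := hw
      exact ⟨c • b, fun x hx => by rw [dotProduct_smul, dotProduct_smul, hb x hx]⟩
  choose b hb using key
  refine ⟨Matrix.of fun i => b (Pi.single i 1), fun x hx => funext fun i => ?_⟩
  have := hb (Pi.single i 1) x hx
  rw [dotProduct_single_one] at this
  rw [this, dotProduct_comm]
  rfl

open Matrix in
/-- A square matrix fixing a spanning family is the identity. -/
theorem Matrix.eq_one_of_mulVec_eq_self_of_span_eq_top {R ι : Type*} [CommRing R]
    [Fintype ι] [DecidableEq ι] {S : Set (ι → R)} (hS : Submodule.span R S = ⊤)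
    {A : Matrix ι ι R} (hA : ∀ w ∈ S, A *ᵥ w = w) : A = 1 := by
  apply Matrix.toLin'.injective
  rw [Matrix.toLin'_one]
  exact LinearMap.ext_on hS fun w hw => by simpa using hA w hw

open Matrix in
/-- Vectors having the same pairing with every member of a spanning family are equal. -/
theorem eq_of_dotProduct_eq_of_span_eq_top {R ι : Type*} [CommRing R]
    [Fintype ι] {S : Set (ι → R)} (hS : Submodule.span R S = ⊤)
    {a b : ι → R} (h : ∀ w ∈ S, w ⬝ᵥ a = w ⬝ᵥ b) : a = b := by
  classical
  apply (dotProductEquiv R ι).injective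
  exact LinearMap.ext_on hS fun w hw => by
    simpa [dotProduct_comm] using h w hw

/-- Rigidity in null coordinates: two full separable decompositions of the
same function have the same number of terms and differ by an invertible matrix B,
with the second factors related by (Bᵀ)⁻¹. -/
theorem rigidity_null_coordinates (n N₁ N₂ : ℕ) (hn : 1 ≤ n) (hN₁ : 1 ≤ N₁) (hN₂ : 1 ≤ N₂)
    (Ω₁ Ω₂ : Set (Fin n → ℝ)) (hΩ₁ : Ω₁.Nonempty) (hΩ₂ : Ω₂.Nonempty)
    (u : (Fin n → ℝ) → Fin N₁ → ℝ) (v : (Fin n → ℝ) → Fin N₁ → ℝ)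
    (ut : (Fin n → ℝ) → Fin N₂ → ℝ) (vt : (Fin n → ℝ) → Fin N₂ → ℝ)
    (hu : Submodule.span ℝ (u '' Ω₁) = ⊤)
    (hv : Submodule.span ℝ (v '' Ω₂) = ⊤)
    (hut : Submodule.span ℝ (ut '' Ω₁) = ⊤)
    (hvt : Submodule.span ℝ (vt '' Ω₂) = ⊤)
    (heq : ∀ ξ ∈ Ω₁, ∀ η ∈ Ω₂, ∑ α, u ξ α * v η α = ∑ α, ut ξ α * vt η α) :
    N₁ = N₂ ∧
    ∃ (B : Matrix (Fin N₂) (Fin N₁) ℝ) (C : Matrix (Fin N₁) (Fin N₂) ℝ),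
      B * C = 1 ∧ C * B = 1 ∧
      (∀ ξ ∈ Ω₁, ut ξ = B.mulVec (u ξ)) ∧
      (∀ η ∈ Ω₂, vt η = C.transpose.mulVec (v η)) := by
  obtain ⟨B, hB⟩ := exists_mulVec_eq_of_dotProduct_eq hvt heq
  obtain ⟨C, hC⟩ := exists_mulVec_eq_of_dotProduct_eq hv
    (fun ξ hξ η hη => (heq ξ hξ η hη).symm)
  have hBC : B * C = 1 := by
    refine Matrix.eq_one_of_mulVec_eq_self_of_span_eq_top hut ?_
    rintro _ ⟨ξ, hξ, rfl⟩
    rw [← Matrix.mulVec_mulVec, ← hC ξ hξ, ← hB ξ hξ]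
  have hCB : C * B = 1 := by
    refine Matrix.eq_one_of_mulVec_eq_self_of_span_eq_top hu ?_
    rintro _ ⟨ξ, hξ, rfl⟩
    rw [← Matrix.mulVec_mulVec, ← hB ξ hξ, ← hC ξ hξ]
  refine ⟨?_, B, C, hBC, hCB, hB, fun η hη => ?_⟩
  · simpa using (Matrix.toLin'OfInv hBC hCB).finrank_eq.symm
  · refine eq_of_dotProduct_eq_of_span_eq_top hut ?_
    rintro _ ⟨ξ, hξ, rfl⟩
    rw [Matrix.dotProduct_mulVec, Matrix.vecMul_transpose, ← hC ξ hξ]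
    exact (heq ξ hξ η hη).symm
end

section
/- Let n, m ≥ 1, let W ⊆ ℝⁿ be a nonempty open connected set, for k = 1,…,n let B_k : W → ℝ^{m×m} be smooth matrix-valued functions, and let V : W → ℝ^m be a smooth map (viewed as a row vector) such that ∂V/∂ξ_k(ξ) + V(ξ)·B_k(ξ) = 0 for all k ∈ {1,…,n} and all ξ ∈ W. If V(ξ₀) = 0 for some ξ₀ ∈ W, then V(ξ) = 0 for all ξ ∈ W. -/
open Filter Topology

section

variable {E F : Type*} [NormedAddCommGroup E] [NormedSpace ℝ E]
  [NormedAddCommGroup F] [NormedSpace ℝ F] {f : E → F}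

/-- Grönwall uniqueness on a convex set: if `‖Df‖ ≤ C ‖f‖` and `f` vanishes at one point,
then `f` vanishes on the whole set. -/
theorem Convex.eq_zero_of_norm_fderiv_le_mul_norm {s : Set E} (hs : Convex ℝ s) {C : ℝ}
    (hf : ∀ x ∈ s, DifferentiableAt ℝ f x) (hC : ∀ x ∈ s, ‖fderiv ℝ f x‖ ≤ C * ‖f x‖)
    {x y : E} (hx : x ∈ s) (hy : y ∈ s) (hfx : f x = 0) : f y = 0 := by
  have hmem (t : ℝ) (ht : t ∈ Set.Icc (0 : ℝ) 1) : AffineMap.lineMap x y t ∈ s :=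
    hs.lineMap_mem hx hy ht
  have hderiv (t : ℝ) (ht : t ∈ Set.Icc (0 : ℝ) 1) :
      HasDerivAt (fun t : ℝ => f (AffineMap.lineMap x y t))
        (fderiv ℝ f (AffineMap.lineMap x y t) (y - x)) t :=
    (hf _ (hmem t ht)).hasFDerivAt.comp_hasDerivAt t AffineMap.hasDerivAt_lineMap
  have hzero := eq_zero_of_abs_deriv_le_mul_abs_self_of_eq_zero_right (K := C * ‖y - x‖)
    (fun t ht => (hderiv t ht).continuousAt.continuousWithinAt)
    (fun t ht => (hderiv t (Set.Ico_subset_Icc_self ht)).hasDerivWithinAt)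
    (by simpa using hfx) (fun t ht => by
      calc ‖fderiv ℝ f (AffineMap.lineMap x y t) (y - x)‖
          ≤ ‖fderiv ℝ f (AffineMap.lineMap x y t)‖ * ‖y - x‖ := ContinuousLinearMap.le_opNorm _ _
        _ ≤ C * ‖f (AffineMap.lineMap x y t)‖ * ‖y - x‖ := by
          gcongr
          exact hC _ (hmem t (Set.Ico_subset_Icc_self ht))
        _ = C * ‖y - x‖ * ‖f (AffineMap.lineMap x y t)‖ := by ring)
  simpa using hzero 1 (by simp)

/-- If `‖Df‖ ≤ C ‖f‖` locally on a preconnected open set and `f` vanishes at one point,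
then `f` vanishes on the whole set. -/
theorem IsPreconnected.eq_zero_of_eventually_norm_fderiv_le_mul_norm {W : Set E}
    (hWc : IsPreconnected W) (hW : IsOpen W) (hf : DifferentiableOn ℝ f W)
    (hC : ∀ x ∈ W, ∃ C : ℝ, ∀ᶠ y in 𝓝 x, ‖fderiv ℝ f y‖ ≤ C * ‖f y‖)
    {x₀ : E} (hx₀ : x₀ ∈ W) (hfx₀ : f x₀ = 0) : ∀ x ∈ W, f x = 0 := by
  have hlocal : ∀ x ∈ W, ∃ r > 0, ∀ y ∈ Metric.ball x r, f y = 0 →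
      ∀ z ∈ Metric.ball x r, f z = 0 := by
    intro x hx
    obtain ⟨C, hCx⟩ := hC x hx
    obtain ⟨r, hr, hball⟩ := Metric.eventually_nhds_iff_ball.1 (hCx.and (hW.mem_nhds hx))
    exact ⟨r, hr, fun y hy hfy z hz =>
      (convex_ball x r).eq_zero_of_norm_fderiv_le_mul_norm
        (fun w hw => hf.differentiableAt (hW.mem_nhds (hball w hw).2))
        (fun w hw => (hball w hw).1) hy hz hfy⟩
  have hsub : W ⊆ {x | ∀ᶠ y in 𝓝 x, f y = 0} := by
    refine hWc.subset_of_closure_inter_subset isOpen_setOfPred_eventually_nhds ⟨x₀, hx₀, ?_⟩ ?_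
    · obtain ⟨r, hr, h⟩ := hlocal x₀ hx₀
      exact eventually_of_mem (Metric.ball_mem_nhds x₀ hr)
        (h x₀ (Metric.mem_ball_self hr) hfx₀)
    · rintro x ⟨hxcl, hxW⟩
      obtain ⟨r, hr, h⟩ := hlocal x hxW
      obtain ⟨y, hyr, hy⟩ := mem_closure_iff_nhds.1 hxcl _ (Metric.ball_mem_nhds x hr)
      exact eventually_of_mem (Metric.ball_mem_nhds x hr) (h y hyr hy.self_of_nhds)
  exact fun x hx => (hsub hx).self_of_nhds

end

/-- A continuous linear map on `ℝⁿ` is bounded by the sum of the norms of its values on the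
standard basis. -/
theorem ContinuousLinearMap.opNorm_le_sum_norm_single {ι F : Type*} [Fintype ι] [DecidableEq ι]
    [NormedAddCommGroup F] [NormedSpace ℝ F] (L : (ι → ℝ) →L[ℝ] F) :
    ‖L‖ ≤ ∑ k, ‖L (Pi.single k 1)‖ := by
  refine L.opNorm_le_bound (by positivity) fun v => ?_
  have hv : L v = ∑ k, v k • L (Pi.single k 1) := by
    conv_lhs => rw [pi_eq_sum_univ' v]
    simp [map_sum]
  rw [hv, Finset.sum_mul]
  refine norm_sum_le_of_le _ fun k _ => ?_
  rw [norm_smul, mul_comm]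
  gcongr
  exact norm_le_pi_norm v k

/-- Sup-norm bound for the product of a row vector with a matrix. -/
theorem norm_sum_mul_le {m : ℕ} (v : Fin m → ℝ) (A : Fin m → Fin m → ℝ) :
    ‖fun j => ∑ i, v i * A i j‖ ≤ m * ‖A‖ * ‖v‖ := by
  refine (pi_norm_le_iff_of_nonneg (by positivity)).2 fun j => ?_
  calc ‖∑ i, v i * A i j‖ ≤ ∑ _i : Fin m, ‖v‖ * ‖A‖ := by
        refine norm_sum_le_of_le _ fun i _ => ?_
        rw [norm_mul]
        gcongr
        · exact norm_le_pi_norm v i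
        · exact (norm_le_pi_norm (A i) j).trans (norm_le_pi_norm A i)
    _ = m * ‖A‖ * ‖v‖ := by simp; ring

/-- Uniqueness: a solution of the linear system ∂V/∂ξ_k + V·B_k = 0 on a
connected open set vanishing at one point vanishes identically. -/
theorem pfaffian_uniqueness (n m : ℕ) (hn : 1 ≤ n) (hm : 1 ≤ m)
    (W : Set (Fin n → ℝ)) (hW : IsOpen W) (hWc : IsConnected W)
    (B : Fin n → (Fin n → ℝ) → Fin m → Fin m → ℝ)
    (hB : ∀ k, ContDiffOn ℝ (⊤ : ℕ∞) (B k) W)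
    (V : (Fin n → ℝ) → Fin m → ℝ)
    (hV : ContDiffOn ℝ (⊤ : ℕ∞) V W)
    (heq : ∀ k : Fin n, ∀ ξ ∈ W,
      fderiv ℝ V ξ (Pi.single k 1) + (fun j => ∑ i, V ξ i * B k ξ i j) = 0)
    (ξ₀ : Fin n → ℝ) (hξ₀ : ξ₀ ∈ W) (hV₀ : V ξ₀ = 0) :
    ∀ ξ ∈ W, V ξ = 0 := by
  refine hWc.isPreconnected.eq_zero_of_eventually_norm_fderiv_le_mul_norm hW
    (hV.differentiableOn (by simp)) (fun ξ hξ => ⟨(∑ k, m * ‖B k ξ‖) + 1, ?_⟩) hξ₀ hV₀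
  have hcont : ContinuousAt (fun η => ∑ k, m * ‖B k η‖) ξ :=
    tendsto_finsetSum _ fun k _ =>
      ((hB k).continuousOn.continuousAt (hW.mem_nhds hξ)).norm.const_mul _
  filter_upwards [hcont.eventually_lt continuousAt_const (lt_add_one _), hW.mem_nhds hξ]
    with η hη hηW
  calc ‖fderiv ℝ V η‖ ≤ ∑ k, ‖fderiv ℝ V η (Pi.single k 1)‖ :=
        ContinuousLinearMap.opNorm_le_sum_norm_single _
    _ ≤ ∑ k, m * ‖B k η‖ * ‖V η‖ := by
        refine Finset.sum_le_sum fun k _ => ?_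
        rw [eq_neg_of_add_eq_zero_left (heq k η hηW), norm_neg]
        exact norm_sum_mul_le _ _
    _ = (∑ k, m * ‖B k η‖) * ‖V η‖ := by rw [Finset.sum_mul]
    _ ≤ ((∑ k, m * ‖B k ξ‖) + 1) * ‖V η‖ := by gcongr
end

section
/- Let n, N ≥ 1, let Ω ⊆ ℝⁿ be a nonempty open connected set with 0 ∈ Ω, and let u, v : Ω → ℝ^N be smooth maps with u(0) = 0 and v(0) = 0 whose differentials are injective at every point of Ω. Define H : Ω × Ω → ℝ by H(ξ,η) = Σ_{α=1}^N u_α(ξ)v_α(η). Then there exist finite sets of multi-indices 𝓘, 𝓙 ⊆ ℕⁿ with 0 ∈ 𝓘 and 0 ∈ 𝓙, and smooth functions a, b : Ω → ℝ, not identically zero on Ω, with a(0) = b(0) = 0, such that for every multi-index K ∈ ℕⁿ there exist smooth functions a^I_K : Ω → ℝ (I ∈ 𝓘) and b^J_K : Ω → ℝ (J ∈ 𝓙) satisfying a(ξ)·∂^K_ξ H(ξ,η) + Σ_{I∈𝓘} a^I_K(ξ)·∂^I_ξ H(ξ,η) = 0 and b(η)·∂^K_η H(ξ,η) + Σ_{J∈𝓙}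 b^J_K(η)·∂^J_η H(ξ,η) = 0 for all (ξ,η) ∈ Ω × Ω. -/
/-- Partial derivative in the i-th coordinate direction. -/
noncomputable def pderiv9 {n : ℕ} (i : Fin n) (f : (Fin n → ℝ) → ℝ) : (Fin n → ℝ) → ℝ :=
  fun x => fderiv ℝ f x (Pi.single i 1)

/-- Iterated multi-index partial derivative ∂^K f = ∂^{|K|} f / ∂x₁^{k₁}⋯∂xₙ^{kₙ}. -/
noncomputable def mderiv9 {n : ℕ} (K : Fin n → ℕ) (f : (Fin n → ℝ) → ℝ) : (Fin n → ℝ) → ℝ :=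
  (List.finRange n).foldr (fun i g => (pderiv9 i)^[K i] g) f

open Matrix

/-- Cramer's rule for the Gram matrix of the rows of `A`, valid also when the rows are dependent. -/
lemma gram_det_smul_eq {m ι : Type*} [Fintype m] [DecidableEq m] [Fintype ι]
    (A : Matrix m ι ℝ) (w : ι → ℝ)
    (hw : LinearIndependent ℝ A.row → w ∈ Submodule.span ℝ (Set.range A.row)) :
    (A * Aᵀ).det • w = ((A * Aᵀ).adjugate *ᵥ (A *ᵥ w)) ᵥ* A := by
  by_cases hdet : (A * Aᵀ).det = 0
  · have h1 : A * Aᵀ * (A * Aᵀ).adjugate = 0 := by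
      rw [Matrix.mul_adjugate, hdet, zero_smul]
    have h2 : Aᵀ * (A * Aᵀ).adjugate = 0 := by
      rw [← Matrix.conjTranspose_eq_transpose_of_trivial A] at h1 ⊢
      exact (Matrix.self_mul_conjTranspose_mul_eq_zero A _).1 h1
    rw [hdet, zero_smul, ← Matrix.mulVec_transpose, Matrix.mulVec_mulVec, h2, Matrix.zero_mulVec]
  · have hli : LinearIndependent ℝ A.row := by
      rw [← Matrix.vecMul_injective_iff]
      have hG : Function.Injective (A * Aᵀ).vecMul :=
        Matrix.vecMul_injective_of_isUnit ((Matrix.isUnit_iff_isUnit_det _).2 (Ne.isUnit hdet))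
      intro x y hxy
      apply hG
      simp only [← Matrix.vecMul_vecMul]
      exact congrArg (· ᵥ* Aᵀ) hxy
    obtain ⟨c, rfl⟩ : ∃ c : m → ℝ, c ᵥ* A = w := by
      obtain ⟨c, hc⟩ := (Submodule.mem_span_range_iff_exists_fun ℝ).1 (hw hli)
      refine ⟨c, ?_⟩
      rw [Matrix.vecMul_eq_sum]
      exact hc
    rw [← Matrix.mulVec_transpose A c, Matrix.mulVec_mulVec _ A, Matrix.mulVec_mulVec,
      Matrix.adjugate_mul, Matrix.smul_mulVec, Matrix.one_mulVec, Matrix.smul_vecMul,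
      Matrix.mulVec_transpose]

/-- A family of vector-valued functions has a finite subfamily that is independent at some point
and spans the whole family wherever it is independent. -/
lemma exists_generically_spanning_subfamily {κ X ι : Type*} [Fintype ι] (f : κ → X → ι → ℝ)
    {Ω : Set X} (hΩ : Ω.Nonempty) :
    ∃ (r : ℕ) (e : Fin r → κ),
      (∃ x ∈ Ω, LinearIndependent ℝ fun i => f (e i) x) ∧
      ∀ x ∈ Ω, ∀ k, (LinearIndependent ℝ fun i => f (e i) x) →
        f k x ∈ Submodule.span ℝ (Set.range fun i => f (e i) x) := by
  classical
  let P : ℕ → Prop := fun r => ∃ e : Fin r → κ, ∃ x ∈ Ω, LinearIndependent ℝ fun i => f (e i) x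
  have hbound : ∀ r, P r → r ≤ Fintype.card ι := by
    rintro r ⟨e, x, -, h⟩
    simpa using h.fintype_card_le_finrank
  have hP0 : P 0 := hΩ.elim fun x hx => ⟨Fin.elim0, x, hx, linearIndependent_empty_type⟩
  obtain ⟨e, x, hx, hli⟩ : P (Nat.findGreatest P (Fintype.card ι)) :=
    Nat.findGreatest_spec (Nat.zero_le _) hP0
  refine ⟨_, e, ⟨x, hx, hli⟩, fun y hy k hliy => ?_⟩
  by_contra hk
  have hsucc : P (Nat.findGreatest P (Fintype.card ι) + 1) := by
    refine ⟨Fin.cons k e, y, hy, ?_⟩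
    have hcons : (fun i => f ((Fin.cons k e : Fin _ → κ) i) y)
        = Fin.cons (f k y) fun i => f (e i) y := by
      funext i
      refine Fin.cases ?_ (fun i => ?_) i <;> simp
    rw [hcons]
    exact linearIndependent_finCons.2 ⟨hliy, hk⟩
  have := Nat.le_findGreatest (hbound _ hsucc) hsucc
  omega

lemma gram_det_ne_zero {m ι : Type*} [Fintype m] [DecidableEq m] [Fintype ι]
    (A : Matrix m ι ℝ) (hA : LinearIndependent ℝ A.row) : (A * Aᵀ).det ≠ 0 := by
  rw [← Matrix.vecMul_injective_iff, ← Matrix.conjTranspose_eq_transpose_of_trivial] at *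
  exact (Matrix.PosDef.mul_conjTranspose_self A hA).det_pos.ne'

lemma contDiffOn_pderiv9 {n : ℕ} {Ω : Set (Fin n → ℝ)} (hΩ : IsOpen Ω) (i : Fin n)
    {f : (Fin n → ℝ) → ℝ} (hf : ContDiffOn ℝ (⊤ : ℕ∞) f Ω) :
    ContDiffOn ℝ (⊤ : ℕ∞) (pderiv9 i f) Ω :=
  (hf.fderiv_of_isOpen hΩ (by simp)).clm_apply contDiffOn_const

lemma pderiv9_eq_sum {n N : ℕ} {Ω : Set (Fin n → ℝ)} (hΩ : IsOpen Ω) (i : Fin n)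
    {c : Fin N → ℝ} {g : (Fin n → ℝ) → ℝ} {f : Fin N → (Fin n → ℝ) → ℝ}
    (hf : ∀ α, ContDiffOn ℝ (⊤ : ℕ∞) (f α) Ω) (hg : ∀ x ∈ Ω, g x = ∑ α, f α x * c α) :
    ∀ x ∈ Ω, pderiv9 i g x = ∑ α, pderiv9 i (f α) x * c α := by
  intro x hx
  have hd : ∀ α, HasFDerivAt (f α) (fderiv ℝ (f α) x) x := fun α =>
    (((hf α).contDiffAt (hΩ.mem_nhds hx)).differentiableAt (by simp)).hasFDerivAt
  have hsum : HasFDerivAt (fun y => ∑ α, f α y * c α) (∑ α, c α • fderiv ℝ (f α) x) x :=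
    HasFDerivAt.fun_sum fun α _ => (hd α).mul_const (c α)
  have hgd : HasFDerivAt g (∑ α, c α • fderiv ℝ (f α) x) x :=
    hsum.congr_of_eventuallyEq (Filter.eventually_of_mem (hΩ.mem_nhds hx) hg)
  simp [pderiv9, hgd.fderiv, mul_comm]

/-- Iterated partial derivatives preserve smoothness and commute with linear combinations. -/
lemma mderiv9_contDiffOn_and_eq_sum {n N : ℕ} {Ω : Set (Fin n → ℝ)} (hΩ : IsOpen Ω)
    (K : Fin n → ℕ) {f : Fin N → (Fin n → ℝ) → ℝ}
    (hf : ∀ α, ContDiffOn ℝ (⊤ : ℕ∞) (f α) Ω) (c : Fin N → ℝ) :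
    (∀ α, ContDiffOn ℝ (⊤ : ℕ∞) (mderiv9 K (f α)) Ω) ∧
      ∀ x ∈ Ω, mderiv9 K (fun y => ∑ α, f α y * c α) x = ∑ α, mderiv9 K (f α) x * c α := by
  unfold mderiv9
  induction List.finRange n with
  | nil => exact ⟨hf, fun _ _ => rfl⟩
  | cons i l ih =>
    simp only [List.foldr_cons]
    induction K i with
    | zero => exact ih
    | succ k ihk =>
      simp only [Function.iterate_succ_apply']
      exact ⟨fun α => contDiffOn_pderiv9 hΩ i (ihk.1 α), pderiv9_eq_sum hΩ i ihk.1 ihk.2⟩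

lemma contDiffOn_dotProduct {E m : Type*} [NormedAddCommGroup E] [NormedSpace ℝ E]
    [Fintype m] {k : WithTop ℕ∞} {Ω : Set E} {f g : E → m → ℝ}
    (hf : ∀ i, ContDiffOn ℝ k (fun x => f x i) Ω) (hg : ∀ i, ContDiffOn ℝ k (fun x => g x i) Ω) :
    ContDiffOn ℝ k (fun x => f x ⬝ᵥ g x) Ω :=
  ContDiffOn.sum fun i _ => (hf i).mul (hg i)

lemma contDiffOn_matrix_det {E m : Type*} [NormedAddCommGroup E] [NormedSpace ℝ E]
    [Fintype m] [DecidableEq m] {k : WithTop ℕ∞} {Ω : Set E} {M : E → Matrix m m ℝ}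
    (hM : ∀ i j, ContDiffOn ℝ k (fun x => M x i j) Ω) :
    ContDiffOn ℝ k (fun x => (M x).det) Ω := by
  simp only [Matrix.det_apply']
  exact ContDiffOn.sum fun σ _ => contDiffOn_const.mul (contDiffOn_prod fun i _ => hM _ _)

lemma contDiffOn_matrix_adjugate {E m : Type*} [NormedAddCommGroup E] [NormedSpace ℝ E]
    [Fintype m] [DecidableEq m] {k : WithTop ℕ∞} {Ω : Set E} {M : E → Matrix m m ℝ}
    (hM : ∀ i j, ContDiffOn ℝ k (fun x => M x i j) Ω) (i j : m) :
    ContDiffOn ℝ k (fun x => (M x).adjugate i j) Ω := by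
  simp only [Matrix.adjugate_apply]
  refine contDiffOn_matrix_det fun p q => ?_
  by_cases hp : p = j
  · simp only [hp, Matrix.updateRow_self]
    exact contDiffOn_const
  · simp only [Matrix.updateRow_ne hp]
    exact hM p q

/-- The partial derivatives of the linear combinations of the components of a smooth map `u`
satisfy finite-type linear relations whose coefficients do not depend on the combination. -/
lemma exists_mderiv9_relations {n N : ℕ} (hn : 1 ≤ n) {Ω : Set (Fin n → ℝ)} (hΩ : IsOpen Ω)
    (hne : Ω.Nonempty) {u : (Fin n → ℝ) → Fin N → ℝ} (hu : ContDiffOn ℝ (⊤ : ℕ∞) u Ω) :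
    ∃ S : Finset (Fin n → ℕ), (0 : Fin n → ℕ) ∈ S ∧
    ∃ a : (Fin n → ℝ) → ℝ, ContDiffOn ℝ (⊤ : ℕ∞) a Ω ∧ (¬ ∀ ξ ∈ Ω, a ξ = 0) ∧ a 0 = 0 ∧
      ∀ K : Fin n → ℕ, ∃ aK : (Fin n → ℕ) → (Fin n → ℝ) → ℝ,
        (∀ I ∈ S, ContDiffOn ℝ (⊤ : ℕ∞) (aK I) Ω) ∧
        ∀ ξ ∈ Ω, ∀ c : Fin N → ℝ,
          a ξ * mderiv9 K (fun ξ' => ∑ α, u ξ' α * c α) ξ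
            + ∑ I ∈ S, aK I ξ * mderiv9 I (fun ξ' => ∑ α, u ξ' α * c α) ξ = 0 := by
  classical
  have hcomp : ∀ α, ContDiffOn ℝ (⊤ : ℕ∞) (fun ξ => u ξ α) Ω := contDiffOn_pi.1 hu
  let w : (Fin n → ℕ) → (Fin n → ℝ) → Fin N → ℝ := fun K ξ α => mderiv9 K (fun ξ' => u ξ' α) ξ
  have hw : ∀ K α, ContDiffOn ℝ (⊤ : ℕ∞) (fun ξ => w K ξ α) Ω := fun K =>
    (mderiv9_contDiffOn_and_eq_sum hΩ K hcomp 0).1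
  have hH : ∀ K, ∀ ξ ∈ Ω, ∀ c : Fin N → ℝ,
      mderiv9 K (fun ξ' => ∑ α, u ξ' α * c α) ξ = w K ξ ⬝ᵥ c := fun K ξ hξ c =>
    (mderiv9_contDiffOn_and_eq_sum hΩ K hcomp c).2 ξ hξ
  obtain ⟨r, e, ⟨x₀, hx₀, hli⟩, hspan⟩ := exists_generically_spanning_subfamily w hne
  let A : (Fin n → ℝ) → Matrix (Fin r) (Fin N) ℝ := fun ξ => Matrix.of fun i => w (e i) ξ
  let G : (Fin n → ℝ) → Matrix (Fin r) (Fin r) ℝ := fun ξ => A ξ * (A ξ)ᵀ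
  have hG : ∀ i j, ContDiffOn ℝ (⊤ : ℕ∞) (fun ξ => G ξ i j) Ω := fun i j =>
    contDiffOn_dotProduct (hw (e i)) (hw (e j))
  have hdet := contDiffOn_matrix_det hG
  let q : (Fin n → ℝ) → ℝ := fun ξ => ∑ i, ξ i ^ 2
  have hq : ContDiffOn ℝ (⊤ : ℕ∞) q Ω := by
    refine ContDiff.contDiffOn ?_
    fun_prop
  let C : (Fin n → ℕ) → (Fin n → ℝ) → Fin r → ℝ := fun K ξ =>
    (G ξ).adjugate *ᵥ (A ξ *ᵥ w K ξ)
  have hC : ∀ K i, ContDiffOn ℝ (⊤ : ℕ∞) (fun ξ => C K ξ i) Ω := fun K i =>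
    contDiffOn_dotProduct (contDiffOn_matrix_adjugate hG i)
      fun j => contDiffOn_dotProduct (hw (e j)) (hw K)
  refine ⟨insert 0 (Finset.univ.image e), Finset.mem_insert_self _ _,
    fun ξ => q ξ * (G ξ).det, hq.mul hdet, ?_, by simp [q], fun K =>
    ⟨fun I ξ => ∑ i, if e i = I then -(q ξ * C K ξ i) else 0, fun I _ => ?_, fun ξ hξ c => ?_⟩⟩
  · intro hzero
    have hopen : IsOpen (Ω ∩ (fun ξ => (G ξ).det) ⁻¹' {0}ᶜ) :=
      hdet.continuousOn.isOpen_inter_preimage hΩ isOpen_compl_singleton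
    have hmem : x₀ ∈ Ω ∩ (fun ξ => (G ξ).det) ⁻¹' {0}ᶜ := ⟨hx₀, gram_det_ne_zero (A x₀) hli⟩
    have : Nonempty (Fin n) := ⟨⟨0, hn⟩⟩
    obtain ⟨y, hy, hy0⟩ := (dense_compl_singleton (0 : Fin n → ℝ)).inter_open_nonempty _ hopen
      ⟨x₀, hmem⟩
    have hqy : q y = 0 := (mul_eq_zero.1 (hzero y hy.1)).resolve_right hy.2
    refine hy0 (funext fun i => ?_)
    have := (Finset.sum_eq_zero_iff_of_nonneg fun i _ => sq_nonneg (y i)).1 hqy i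
      (Finset.mem_univ i)
    simpa using this
  · refine ContDiffOn.sum fun i _ => ?_
    by_cases h : e i = I
    · simpa only [h, if_true] using (hq.mul (hC K i)).neg
    · simpa only [h, if_false] using contDiffOn_const
  · have hcramer : (G ξ).det • w K ξ = C K ξ ᵥ* A ξ :=
      gram_det_smul_eq (A ξ) (w K ξ) (hspan ξ hξ K)
    have hrel : (G ξ).det * (w K ξ ⬝ᵥ c) = ∑ i, C K ξ i * (w (e i) ξ ⬝ᵥ c) := by
      rw [← smul_eq_mul, ← smul_dotProduct, hcramer, ← Matrix.dotProduct_mulVec]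
      rfl
    simp only [hH _ ξ hξ c, Finset.sum_mul, ite_mul, zero_mul]
    rw [Finset.sum_comm]
    simp only [Finset.sum_ite_eq, Finset.mem_insert, Finset.mem_image, Finset.mem_univ, true_and,
      exists_apply_eq_apply, or_true, if_true]
    rw [mul_assoc, hrel, Finset.mul_sum, ← Finset.sum_add_distrib]
    exact Finset.sum_eq_zero fun i _ => by ring

/-- Necessity part of the main theorem: a separable decomposition
H(ξ,η) = Σ u_α(ξ)v_α(η) coming from an immersion forces finite-type linear dependence
relations among the partial derivatives of H. -/
theorem necessity_dependence_relations (n N : ℕ) (hn : 1 ≤ n) (hN : 1 ≤ N)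
    (Ω : Set (Fin n → ℝ)) (hΩ : IsOpen Ω) (hΩc : IsConnected Ω)
    (h0 : (0 : Fin n → ℝ) ∈ Ω)
    (u v : (Fin n → ℝ) → Fin N → ℝ)
    (hu : ContDiffOn ℝ (⊤ : ℕ∞) u Ω) (hv : ContDiffOn ℝ (⊤ : ℕ∞) v Ω)
    (hu0 : u 0 = 0) (hv0 : v 0 = 0)
    (hdu : ∀ ξ ∈ Ω, Function.Injective (fderiv ℝ u ξ))
    (hdv : ∀ ξ ∈ Ω, Function.Injective (fderiv ℝ v ξ)) :
    ∃ (S T : Finset (Fin n → ℕ)), (0 : Fin n → ℕ) ∈ S ∧ (0 : Fin n → ℕ) ∈ T ∧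
    ∃ a b : (Fin n → ℝ) → ℝ,
      ContDiffOn ℝ (⊤ : ℕ∞) a Ω ∧ ContDiffOn ℝ (⊤ : ℕ∞) b Ω ∧
      (¬ ∀ ξ ∈ Ω, a ξ = 0) ∧ (¬ ∀ η ∈ Ω, b η = 0) ∧
      a 0 = 0 ∧ b 0 = 0 ∧
      ∀ K : Fin n → ℕ,
        (∃ aK : (Fin n → ℕ) → (Fin n → ℝ) → ℝ,
          (∀ I ∈ S, ContDiffOn ℝ (⊤ : ℕ∞) (aK I) Ω) ∧
          ∀ ξ ∈ Ω, ∀ η ∈ Ω,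
            a ξ * mderiv9 K (fun ξ' => ∑ α, u ξ' α * v η α) ξ
              + ∑ I ∈ S, aK I ξ * mderiv9 I (fun ξ' => ∑ α, u ξ' α * v η α) ξ = 0) ∧
        (∃ bK : (Fin n → ℕ) → (Fin n → ℝ) → ℝ,
          (∀ J ∈ T, ContDiffOn ℝ (⊤ : ℕ∞) (bK J) Ω) ∧
          ∀ ξ ∈ Ω, ∀ η ∈ Ω,
            b η * mderiv9 K (fun η' => ∑ α, u ξ α * v η' α) η
              + ∑ J ∈ T, bK J η * mderiv9 J (fun η' => ∑ α, u ξ α * v η' α) η = 0) := by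
  obtain ⟨S, hS, a, ha, ha', ha0, hK⟩ := exists_mderiv9_relations hn hΩ hΩc.nonempty hu
  obtain ⟨T, hT, b, hb, hb', hb0, hL⟩ := exists_mderiv9_relations hn hΩ hΩc.nonempty hv
  refine ⟨S, T, hS, hT, a, b, ha, hb, ha', hb', ha0, hb0, fun K => ⟨?_, ?_⟩⟩
  · obtain ⟨aK, h1, h2⟩ := hK K
    exact ⟨aK, h1, fun ξ hξ η _ => h2 ξ hξ (v η)⟩
  · obtain ⟨bK, h1, h2⟩ := hL K
    refine ⟨bK, h1, fun ξ _ η hη => ?_⟩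
    simpa only [mul_comm (u ξ _)] using h2 η hη (u ξ)
end

section
/- Let n, h, k be positive integers and define H : ℝⁿ × ℝⁿ → ℝ by H(ξ,η) = Σ_{i=1}^n ξᵢηᵢ + (ξ₁² + ⋯ + ξₙ²)^h (η₁² + ⋯ + ηₙ²)^k. Then for every multi-index I ∈ ℕⁿ with |I| ≥ 2 there exists a smooth function a_I : ℝⁿ → ℝ such that (η₁² + ⋯ + ηₙ²)^k · ∂^I_η H(ξ,η) + a_I(η) · ( Σ_{i=1}^n ηᵢ ∂H/∂ηᵢ(ξ,η) − H(ξ,η) ) = 0 for all (ξ,η) ∈ ℝⁿ × ℝⁿ. -/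
/-- Partial derivative in the i-th coordinate direction. -/
noncomputable def pderiv11 {n : ℕ} (i : Fin n) (f : (Fin n → ℝ) → ℝ) : (Fin n → ℝ) → ℝ :=
  fun x => fderiv ℝ f x (Pi.single i 1)

/-- Iterated multi-index partial derivative ∂^K f = ∂^{|K|} f / ∂x₁^{k₁}⋯∂xₙ^{kₙ}. -/
noncomputable def mderiv11 {n : ℕ} (K : Fin n → ℕ) (f : (Fin n → ℝ) → ℝ) : (Fin n → ℝ) → ℝ :=
  (List.finRange n).foldr (fun i g => (pderiv11 i)^[K i] g) f

open scoped ContDiff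

variable {n : ℕ}

lemma ContDiff.pderiv11 {f : (Fin n → ℝ) → ℝ} (hf : ContDiff ℝ ∞ f) (i : Fin n) :
    ContDiff ℝ ∞ (pderiv11 i f) :=
  (hf.fderiv_right (m := ∞) (by simp)).clm_apply contDiff_const

lemma ContDiff.foldr_pderiv11 {f : (Fin n → ℝ) → ℝ} (hf : ContDiff ℝ ∞ f) (l : List (Fin n)) :
    ContDiff ℝ ∞ (l.foldr _root_.pderiv11 f) := by
  induction l with
  | nil => exact hf
  | cons i l ih => exact ih.pderiv11 i

lemma pderiv11_add_const_mul {f g : (Fin n → ℝ) → ℝ} (hf : ContDiff ℝ ∞ f)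
    (hg : ContDiff ℝ ∞ g) (c : ℝ) (i : Fin n) :
    pderiv11 i (fun x => f x + c * g x) = fun x => pderiv11 i f x + c * pderiv11 i g x := by
  funext x
  have hf' := (hf.differentiable (by simp) x).hasFDerivAt
  have hg' := (hg.differentiable (by simp) x).hasFDerivAt
  simp [pderiv11, (hf'.fun_add (hg'.const_mul c)).fderiv]

lemma foldr_pderiv11_add_const_mul {f g : (Fin n → ℝ) → ℝ} (hf : ContDiff ℝ ∞ f)
    (hg : ContDiff ℝ ∞ g) (c : ℝ) (l : List (Fin n)) :
    l.foldr pderiv11 (fun x => f x + c * g x) =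
      fun x => l.foldr pderiv11 f x + c * l.foldr pderiv11 g x := by
  induction l with
  | nil => rfl
  | cons i l ih =>
    simp only [List.foldr_cons, ih]
    exact pderiv11_add_const_mul (hf.foldr_pderiv11 l) (hg.foldr_pderiv11 l) c i

lemma pderiv11_const (c : ℝ) (i : Fin n) : pderiv11 i (fun _ => c) = fun _ => 0 := by
  funext x
  simp [pderiv11]

lemma pderiv11_linear (ξ : Fin n → ℝ) (i : Fin n) :
    pderiv11 i (fun x => ∑ j, ξ j * x j) = fun _ => ξ i := by
  funext x
  have hd : HasFDerivAt (fun x : Fin n → ℝ => ∑ j, ξ j * x j)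
      (∑ j, ξ j • ContinuousLinearMap.proj (R := ℝ) (φ := fun _ : Fin n => ℝ) j) x :=
    HasFDerivAt.fun_sum fun j _ => (hasFDerivAt_apply j x).const_mul (ξ j)
  simp [pderiv11, hd.fderiv, Pi.single_apply]

lemma pderiv11_sum_sq_pow (k : ℕ) (i : Fin n) (x : Fin n → ℝ) :
    pderiv11 i (fun x => (∑ j, x j ^ 2) ^ k) x = k * (∑ j, x j ^ 2) ^ (k - 1) * (2 * x i) := by
  have hd : HasFDerivAt (fun x : Fin n → ℝ => ∑ j, x j ^ 2)
      (∑ j, (2 * x j) • ContinuousLinearMap.proj (R := ℝ) (φ := fun _ : Fin n => ℝ) j) x :=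
    HasFDerivAt.fun_sum fun j _ => by
      simpa using HasFDerivAt.pow (hasFDerivAt_apply (𝕜 := ℝ) j x) 2
  simp [pderiv11, (HasFDerivAt.pow hd k).fderiv, Pi.single_apply]

lemma foldr_pderiv11_linear (ξ : Fin n → ℝ) (l : List (Fin n)) (hl : 2 ≤ l.length) :
    l.foldr pderiv11 (fun x => ∑ j, ξ j * x j) = fun _ => 0 := by
  induction l with
  | nil => simp at hl
  | cons i l ih =>
    match l, hl, ih with
    | [j], _, _ => simp [pderiv11_linear, pderiv11_const]
    | j :: j' :: l, _, ih => rw [List.foldr_cons, ih (by simp), pderiv11_const]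

lemma mderiv11_eq_foldr (I : Fin n → ℕ) (f : (Fin n → ℝ) → ℝ) :
    mderiv11 I f =
      ((List.finRange n).flatMap fun i => List.replicate (I i) i).foldr pderiv11 f := by
  have hrep (m : ℕ) (i : Fin n) (g : (Fin n → ℝ) → ℝ) :
      (List.replicate m i).foldr pderiv11 g = (pderiv11 i)^[m] g := by
    induction m with
    | zero => rfl
    | succ m ih => rw [List.replicate_succ, List.foldr_cons, ih, Function.iterate_succ_apply']
  unfold mderiv11
  induction List.finRange n with
  | nil => rfl
  | cons i l ih => rw [List.foldr_cons, List.flatMap_cons, List.foldr_append, ← ih, hrep]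

/-- The function H(ξ,η) = Σξᵢηᵢ + (Σξᵢ²)^h (Σηᵢ²)^k satisfies, for every
multi-index I with |I| ≥ 2, a dependence relation with coefficient (Σηᵢ²)^k. -/
theorem example_dependence_relations (n h k : ℕ) (hn : 1 ≤ n) (hh : 1 ≤ h) (hk : 1 ≤ k) :
    ∀ I : Fin n → ℕ, 2 ≤ ∑ i, I i →
      ∃ a : (Fin n → ℝ) → ℝ, ContDiff ℝ (⊤ : ℕ∞) a ∧
        ∀ ξ η : Fin n → ℝ,
          (∑ i, η i ^ 2) ^ k *
              mderiv11 I (fun η' => ∑ i, ξ i * η' i + (∑ i, ξ i ^ 2) ^ h * (∑ i, η' i ^ 2) ^ k) η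
            + a η *
              ((∑ i, η i *
                  pderiv11 i (fun η' => ∑ j, ξ j * η' j + (∑ j, ξ j ^ 2) ^ h * (∑ j, η' j ^ 2) ^ k) η)
                - (∑ i, ξ i * η i + (∑ i, ξ i ^ 2) ^ h * (∑ i, η i ^ 2) ^ k)) = 0 := by
  intro I hI
  have hlin (ξ : Fin n → ℝ) : ContDiff ℝ ∞ fun x : Fin n → ℝ => ∑ i, ξ i * x i := by fun_prop
  have hpow : ContDiff ℝ ∞ fun x : Fin n → ℝ => (∑ i, x i ^ 2) ^ k := by fun_prop
  have hk' : (2 * k - 1 : ℝ) ≠ 0 := by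
    have : (1 : ℝ) ≤ k := by exact_mod_cast hk
    linarith
  simp only [mderiv11_eq_foldr]
  set l := (List.finRange n).flatMap fun i => List.replicate (I i) i with hl
  have hlen : 2 ≤ l.length := by
    simpa [hl, List.length_flatMap, ← List.ofFn_eq_map, List.sum_ofFn] using hI
  refine ⟨fun x => -(l.foldr pderiv11 (fun x => (∑ i, x i ^ 2) ^ k) x / (2 * k - 1)),
    ((hpow.foldr_pderiv11 l).div_const _).neg, fun ξ η => ?_⟩
  have euler : ∑ i, η i * (ξ i + (∑ j, ξ j ^ 2) ^ h *
      (k * (∑ j, η j ^ 2) ^ (k - 1) * (2 * η i))) =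
      ∑ i, ξ i * η i + 2 * k * ((∑ j, ξ j ^ 2) ^ h * (∑ j, η j ^ 2) ^ k) := by
    rw [← Nat.sub_add_cancel hk, pow_succ (∑ j, η j ^ 2) (k - 1), Nat.sub_add_cancel hk,
      ← mul_assoc (_ ^ h), ← mul_assoc (2 * (k : ℝ)), Finset.mul_sum, ← Finset.sum_add_distrib]
    exact Finset.sum_congr rfl fun i _ => by ring
  simp only [foldr_pderiv11_add_const_mul (hlin ξ) hpow, foldr_pderiv11_linear ξ l hlen,
    pderiv11_add_const_mul (hlin ξ) hpow, pderiv11_linear, pderiv11_sum_sq_pow, euler]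
  field_simp
  ring
end

section
/- For i ∈ ℕ define u_i : ℝ → ℝ by u_i(ξ) = exp(−1/(ξ−i)^{i+1}) if ξ > i and u_i(ξ) = 0 if ξ ≤ i, and define Φ : ℝ × ℝ → ℝ by Φ(ξ,η) = ξη + Σ_{i=0}^∞ u_i(ξ) η^{2i+3} (for each fixed ξ only finitely many summands are nonzero). Then for every m ∈ ℕ: (a) Φ(ξ,η) = ξη + Σ_{j=0}^m u_j(ξ) η^{2j+3} for all (ξ,η) ∈ (−∞, m+1) × ℝ, so the restriction of Φ to (−∞, m+1) × ℝ admits a separable decomposition with m+2 terms; and (b) there exist no M < m+2 and functions f_β, g_β : ℝ → ℝ (β = 1,…,M), with f_β defined on (−∞, m+1), such that Φ(ξ,η) = Σ_{β=1}^M f_β(ξ)g_β(η) for all (ξ,η) ∈ (−∞, m+1) × ℝ. -/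
/-- The smooth non-analytic bump functions u_i of Section 3.3. -/
noncomputable def uFun12 (i : ℕ) (ξ : ℝ) : ℝ :=
  if (i : ℝ) < ξ then Real.exp (-1 / (ξ - (i : ℝ)) ^ (i + 1)) else 0

/-- The global potential Φ(ξ,η) = ξη + Σ_{i=0}^∞ u_i(ξ) η^{2i+3} of Section 3.3. -/
noncomputable def Phi12 (ξ η : ℝ) : ℝ :=
  ξ * η + ∑' i : ℕ, uFun12 i ξ * η ^ (2 * i + 3)

theorem uFun12_eq_zero {i : ℕ} {ξ : ℝ} (h : ξ ≤ i) : uFun12 i ξ = 0 :=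
  if_neg h.not_gt

theorem uFun12_ne_zero {i : ℕ} {ξ : ℝ} (h : (i : ℝ) < ξ) : uFun12 i ξ ≠ 0 := by
  rw [uFun12, if_pos h]
  exact Real.exp_ne_zero _

theorem Phi12_eq_sum_range (m : ℕ) {ξ : ℝ} (hξ : ξ < (m : ℝ) + 1) (η : ℝ) :
    Phi12 ξ η = ξ * η + ∑ j ∈ Finset.range (m + 1), uFun12 j ξ * η ^ (2 * j + 3) := by
  rw [Phi12, tsum_eq_sum]
  intro j hj
  have hmj : ((m + 1 : ℕ) : ℝ) ≤ j := by
    exact_mod_cast not_lt.mp (fun h => hj (Finset.mem_range.mpr h))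
  push_cast at hmj
  rw [uFun12_eq_zero (hξ.le.trans hmj), zero_mul]

/-- The coefficients of `η ↦ Phi12 ξ η` with respect to the odd powers of `η`. -/
noncomputable def phiCoeff (m : ℕ) (ξ : ℝ) : Fin (m + 2) → ℝ :=
  Fin.cons ξ fun j : Fin (m + 1) => uFun12 j ξ

theorem Phi12_eq_sum_phiCoeff (m : ℕ) {ξ : ℝ} (hξ : ξ < (m : ℝ) + 1) (η : ℝ) :
    Phi12 ξ η = ∑ j, phiCoeff m ξ j * η ^ (2 * (j : ℕ) + 1) := by
  rw [Phi12_eq_sum_range m hξ, Fin.sum_univ_succ, Finset.sum_range]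
  simp [phiCoeff, mul_add]

/-- The coefficient vectors at the points `k - 1/2` form a lower triangular matrix with nonzero
diagonal. -/
theorem det_phiCoeff_ne_zero (m : ℕ) :
    (Matrix.of fun k : Fin (m + 2) => phiCoeff m ((k : ℝ) - 1 / 2)).det ≠ 0 := by
  rw [Matrix.det_of_isLowerTriangular]
  · refine Finset.prod_ne_zero_iff.mpr fun k _ => ?_
    induction k using Fin.cases with
    | zero => norm_num [phiCoeff]
    | succ i =>
      simp only [Matrix.of_apply, phiCoeff, Fin.cons_succ]
      apply uFun12_ne_zero
      push_cast [Fin.val_succ]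
      linarith
  · intro k j hkj
    induction j using Fin.cases with
    | zero => exact absurd (OrderDual.toDual_lt_toDual.mp hkj) (Fin.not_lt_zero k)
    | succ i =>
      simp only [Matrix.of_apply, phiCoeff, Fin.cons_succ]
      apply uFun12_eq_zero
      have hki : (k : ℕ) ≤ i := Nat.lt_succ_iff.mp hkj
      have hki' : (k : ℝ) ≤ (i : ℕ) := by exact_mod_cast hki
      linarith

/-- The odd powers `η, η³, …` have nonzero determinant at distinct positive points. -/
theorem det_odd_pow_ne_zero {n : ℕ} {v : Fin n → ℝ} (hpos : ∀ i, 0 < v i)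
    (hinj : Function.Injective v) :
    (Matrix.of fun j l : Fin n => v l ^ (2 * (j : ℕ) + 1)).det ≠ 0 := by
  have hfactor : (Matrix.of fun j l : Fin n => v l ^ (2 * (j : ℕ) + 1)) =
      (Matrix.vandermonde fun l => v l ^ 2).transpose * Matrix.diagonal v := by
    ext j l
    simp [Matrix.mul_diagonal, Matrix.vandermonde_apply, pow_succ, pow_mul]
  rw [hfactor, Matrix.det_mul, Matrix.det_transpose, Matrix.det_diagonal]
  refine mul_ne_zero (Matrix.det_vandermonde_ne_zero_iff.mpr fun a b hab => hinj ?_)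
    (Finset.prod_ne_zero_iff.mpr fun i _ => (hpos i).ne')
  exact (pow_left_inj₀ (hpos a).le (hpos b).le two_ne_zero).mp hab

/-- A nonsingular sample matrix of size `n` bounds below the number of separable terms. -/
theorem le_of_det_ne_zero_of_separable {n M : ℕ} {A : Matrix (Fin n) (Fin n) ℝ}
    (hA : A.det ≠ 0) (F G : Fin n → Fin M → ℝ) (h : ∀ k l, A k l = ∑ β, F k β * G l β) :
    n ≤ M := by
  have hfactor : A = Matrix.of F * (Matrix.of G).transpose := by
    ext k l
    simp [Matrix.mul_apply, h]
  have hrank : A.rank = n := by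
    simpa using Matrix.rank_of_isUnit A ((Matrix.isUnit_iff_isUnit_det A).mpr hA.isUnit)
  calc n = A.rank := hrank.symm
    _ ≤ (Matrix.of F).rank := hfactor ▸ Matrix.rank_mul_le_left _ _
    _ ≤ M := by simpa using Matrix.rank_le_card_width (Matrix.of F)

/-- On (−∞, m+1) × ℝ the potential Φ is given by a finite sum, hence
admits a separable decomposition with m+2 terms, and no separable decomposition
with fewer than m+2 terms exists there. -/
theorem potential_minimal_decomposition (m : ℕ) :
    (∀ ξ : ℝ, ξ < (m : ℝ) + 1 → ∀ η : ℝ,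
        Phi12 ξ η = ξ * η + ∑ j ∈ Finset.range (m + 1), uFun12 j ξ * η ^ (2 * j + 3)) ∧
    (∃ f g : ℝ → Fin (m + 2) → ℝ,
        ∀ ξ : ℝ, ξ < (m : ℝ) + 1 → ∀ η : ℝ, Phi12 ξ η = ∑ β, f ξ β * g η β) ∧
    (∀ M : ℕ, M < m + 2 →
      ¬ ∃ f g : ℝ → Fin M → ℝ,
          ∀ ξ : ℝ, ξ < (m : ℝ) + 1 → ∀ η : ℝ, Phi12 ξ η = ∑ β, f ξ β * g η β) := by
  refine ⟨fun ξ hξ η => Phi12_eq_sum_range m hξ η,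
    ⟨phiCoeff m, fun η j => η ^ (2 * (j : ℕ) + 1), fun ξ hξ η => Phi12_eq_sum_phiCoeff m hξ η⟩, ?_⟩
  rintro M hM ⟨f, g, hfg⟩
  have hlt (k : Fin (m + 2)) : (k : ℝ) - 1 / 2 < (m : ℝ) + 1 := by
    have hk : ((k : ℕ) : ℝ) ≤ (m + 1 : ℕ) := by exact_mod_cast Nat.lt_succ_iff.mp k.isLt
    push_cast at hk
    linarith
  have hdet := mul_ne_zero (det_phiCoeff_ne_zero m)
    (det_odd_pow_ne_zero (v := fun l : Fin (m + 2) => (l : ℝ) + 1) (fun l => by positivity)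
      fun a b hab => Fin.ext (by simpa using hab))
  rw [← Matrix.det_mul] at hdet
  refine hM.not_ge (le_of_det_ne_zero_of_separable hdet
    (fun k => f ((k : ℝ) - 1 / 2)) (fun l => g ((l : ℝ) + 1)) fun k l => ?_)
  rw [← hfg _ (hlt k), Phi12_eq_sum_phiCoeff m (hlt k)]
  simp [Matrix.mul_apply]
end

section
/- For i ∈ ℕ define u_i : ℝ → ℝ by u_i(ξ) = exp(−1/(ξ−i)^{i+1}) if ξ > i and u_i(ξ) = 0 if ξ ≤ i, and define Φ : ℝ × ℝ → ℝ by Φ(ξ,η) = ξη + Σ_{i=0}^∞ u_i(ξ) η^{2i+3} (for each fixed ξ only finitely many summands are nonzero). Then Φ is a smooth function on ℝ², and there exist no N ∈ ℕ and functions f_α, g_α : ℝ → ℝ (α = 1,…,N) such that Φ(ξ,η) = Σ_{α=1}^N f_α(ξ)g_α(η) for all (ξ,η) ∈ ℝ × ℝ. -/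
/-- The smooth non-analytic bump functions u_i of Section 3.3. -/
noncomputable def uFun13 (i : ℕ) (ξ : ℝ) : ℝ :=
  if (i : ℝ) < ξ then Real.exp (-1 / (ξ - (i : ℝ)) ^ (i + 1)) else 0

/-- The global potential Φ(ξ,η) = ξη + Σ_{i=0}^∞ u_i(ξ) η^{2i+3} of Section 3.3. -/
noncomputable def Phi13 (ξ η : ℝ) : ℝ :=
  ξ * η + ∑' i : ℕ, uFun13 i ξ * η ^ (2 * i + 3)

open Polynomial Filter Topology

/-- The function equal to `exp (-1 / x ^ q)` for `x > 0` and to `0` for `x ≤ 0`. -/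
noncomputable def expNegInvPowGlue (q : ℕ) (x : ℝ) : ℝ :=
  if 0 < x then Real.exp (-1 / x ^ q) else 0

namespace expNegInvPowGlue

theorem zero_of_nonpos (q : ℕ) {x : ℝ} (hx : x ≤ 0) : expNegInvPowGlue q x = 0 := by
  simp [expNegInvPowGlue, hx.not_gt]

theorem nonneg (q : ℕ) (x : ℝ) : 0 ≤ expNegInvPowGlue q x := by
  unfold expNegInvPowGlue
  split_ifs <;> positivity

theorem le_expNegInvGlue {q : ℕ} (hq : q ≠ 0) {x : ℝ} (hx : x < 1) :
    expNegInvPowGlue q x ≤ expNegInvGlue x := by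
  rcases le_or_gt x 0 with h | h
  · rw [zero_of_nonpos q h, expNegInvGlue.zero_of_nonpos h]
  · have hle : x⁻¹ ≤ (x ^ q)⁻¹ :=
      inv_anti₀ (pow_pos h q) (pow_le_of_le_one h.le hx.le hq)
    simp only [expNegInvPowGlue, expNegInvGlue, h, h.not_ge, if_true, if_false]
    rw [Real.exp_le_exp, neg_div, one_div]
    exact neg_le_neg hle

theorem tendsto_polynomial_inv_mul_zero {q : ℕ} (hq : q ≠ 0) (p : ℝ[X]) :
    Tendsto (fun x ↦ p.eval x⁻¹ * expNegInvPowGlue q x) (𝓝 0) (𝓝 0) := by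
  refine squeeze_zero_norm' ?_
    (by simpa using (expNegInvGlue.tendsto_polynomial_inv_mul_zero p).norm)
  filter_upwards [gt_mem_nhds (zero_lt_one' ℝ)] with x hx
  rw [norm_mul, Real.norm_of_nonneg (nonneg q x), abs_of_nonneg (expNegInvGlue.nonneg x),
    Real.norm_eq_abs]
  exact mul_le_mul_of_nonneg_left (le_expNegInvGlue hq hx) (abs_nonneg _)

theorem hasDerivAt_polynomial_eval_inv_mul {q : ℕ} (hq : q ≠ 0) (p : ℝ[X]) (x : ℝ) :
    HasDerivAt (fun x ↦ p.eval x⁻¹ * expNegInvPowGlue q x)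
      ((C (q : ℝ) * X ^ (q + 1) * p - X ^ 2 * derivative p).eval x⁻¹ *
        expNegInvPowGlue q x) x := by
  rcases lt_trichotomy x 0 with hx | rfl | hx
  · rw [zero_of_nonpos q hx.le, mul_zero]
    refine (hasDerivAt_const _ 0).congr_of_eventuallyEq ?_
    filter_upwards [gt_mem_nhds hx] with y hy
    rw [zero_of_nonpos q hy.le, mul_zero]
  · rw [zero_of_nonpos q le_rfl, mul_zero, hasDerivAt_iff_tendsto_slope]
    refine ((tendsto_polynomial_inv_mul_zero hq (p * X)).mono_left inf_le_left).congr fun x ↦ ?_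
    simp [slope_def_field, div_eq_mul_inv, mul_right_comm, zero_of_nonpos q le_rfl]
  · have hp := (p.hasDerivAt x⁻¹).comp x (hasDerivAt_inv hx.ne')
    have he : HasDerivAt (fun y : ℝ ↦ Real.exp (-(y⁻¹ ^ q)))
        (Real.exp (-(x⁻¹ ^ q)) * (q * x⁻¹ ^ (q + 1))) x := by
      convert! ((hasDerivAt_inv hx.ne').pow q).neg.exp using 2
      obtain ⟨r, rfl⟩ := Nat.exists_eq_succ_of_ne_zero hq
      simp
      ring
    convert! (hp.mul he).congr_of_eventuallyEq _ using 1
    · simp [expNegInvPowGlue, hx, neg_div]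
      ring
    · filter_upwards [lt_mem_nhds hx] with y hy
      simp [expNegInvPowGlue, hy, neg_div]

theorem contDiff_polynomial_eval_inv_mul {q : ℕ} (hq : q ≠ 0) {n : ℕ∞} (p : ℝ[X]) :
    ContDiff ℝ n (fun x ↦ p.eval x⁻¹ * expNegInvPowGlue q x) := by
  apply contDiff_all_iff_nat.2 (fun m => ?_) n
  induction m generalizing p with
  | zero =>
    exact contDiff_zero.2 <| continuous_iff_continuousAt.2 fun x ↦
      (hasDerivAt_polynomial_eval_inv_mul hq p x).continuousAt
  | succ m ihm =>
    rw [show ((m + 1 : ℕ) : WithTop ℕ∞) = m + 1 from rfl]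
    refine contDiff_succ_iff_deriv.2
      ⟨fun x ↦ (hasDerivAt_polynomial_eval_inv_mul hq p x).differentiableAt, by simp, ?_⟩
    convert! ihm (C (q : ℝ) * X ^ (q + 1) * p - X ^ 2 * derivative p) using 2
    exact (hasDerivAt_polynomial_eval_inv_mul hq p _).deriv

protected theorem contDiff {q : ℕ} (hq : q ≠ 0) {n : ℕ∞} :
    ContDiff ℝ n (expNegInvPowGlue q) := by
  simpa using contDiff_polynomial_eval_inv_mul hq 1

end expNegInvPowGlue

theorem uFun13_eq_expNegInvPowGlue (i : ℕ) (ξ : ℝ) :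
    uFun13 i ξ = expNegInvPowGlue (i + 1) (ξ - i) := by
  simp [uFun13, expNegInvPowGlue]

theorem contDiff_uFun13 (i : ℕ) {n : ℕ∞} : ContDiff ℝ n (uFun13 i) := by
  rw [funext (uFun13_eq_expNegInvPowGlue i)]
  exact (expNegInvPowGlue.contDiff i.succ_ne_zero).comp (contDiff_id.sub contDiff_const)

theorem uFun13_of_le {i : ℕ} {ξ : ℝ} (h : ξ ≤ i) : uFun13 i ξ = 0 := by
  simp [uFun13, h.not_gt]

theorem uFun13_pos {i : ℕ} {ξ : ℝ} (h : (i : ℝ) < ξ) : 0 < uFun13 i ξ := by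
  simp [uFun13, h, Real.exp_pos]

theorem Phi13_eq_sum_range {n : ℕ} {ξ : ℝ} (h : ξ ≤ n) (η : ℝ) :
    Phi13 ξ η = ξ * η + ∑ i ∈ Finset.range n, uFun13 i ξ * η ^ (2 * i + 3) := by
  rw [Phi13, tsum_eq_sum fun i hi ↦ ?_]
  have hn : (n : ℝ) ≤ i := by simpa using hi
  rw [uFun13_of_le (h.trans hn), zero_mul]

theorem contDiff_Phi13 {n : ℕ∞} : ContDiff ℝ n (fun p : ℝ × ℝ => Phi13 p.1 p.2) := by
  refine contDiff_iff_contDiffAt.2 fun p ↦ ?_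
  obtain ⟨m, hm⟩ := exists_nat_gt p.1
  have hsum : ContDiff ℝ n (fun p : ℝ × ℝ =>
      p.1 * p.2 + ∑ i ∈ Finset.range m, uFun13 i p.1 * p.2 ^ (2 * i + 3)) :=
    (contDiff_fst.mul contDiff_snd).add <| ContDiff.sum fun i _ ↦
      ((contDiff_uFun13 i).comp contDiff_fst).mul (contDiff_snd.pow _)
  refine hsum.contDiffAt.congr_of_eventuallyEq ?_
  filter_upwards [continuous_fst.continuousAt.eventually (gt_mem_nhds hm)] with y hy
  exact Phi13_eq_sum_range hy.le y.2

/-- The polynomial in `η` which agrees with `Phi13 ξ η` for `ξ ≤ n`. -/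
noncomputable def phiPolynomial (n : ℕ) (ξ : ℝ) : ℝ[X] :=
  C ξ * X + ∑ i ∈ Finset.range n, C (uFun13 i ξ) * X ^ (2 * i + 3)

theorem eval_phiPolynomial {n : ℕ} {ξ : ℝ} (h : ξ ≤ n) (η : ℝ) :
    (phiPolynomial n ξ).eval η = Phi13 ξ η := by
  simp [phiPolynomial, Phi13_eq_sum_range h, eval_finsetSum]

theorem coeff_phiPolynomial {n m : ℕ} (hm : m < n) (ξ : ℝ) :
    (phiPolynomial n ξ).coeff (2 * m + 3) = uFun13 m ξ := by
  simp [phiPolynomial, coeff_X_pow, hm]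

/-- The functions `Phi13 (k + 1)`, for `k < n`, are linearly independent. -/
theorem linearIndependent_Phi13 (n : ℕ) :
    LinearIndependent ℝ (fun k : Fin n ↦ Phi13 ((k : ℝ) + 1)) := by
  refine Fintype.linearIndependent_iff.2 fun c hc ↦ ?_
  have hpoly : ∑ k : Fin n, C (c k) * phiPolynomial n ((k : ℝ) + 1) = 0 := by
    refine Polynomial.funext fun η ↦ ?_
    have hle (k : Fin n) : (k : ℝ) + 1 ≤ n := mod_cast k.isLt
    simpa [eval_finsetSum, eval_phiPolynomial (hle _)] using congrFun hc η
  let A : Matrix (Fin n) (Fin n) ℝ := Matrix.of fun k m ↦ uFun13 m ((k : ℝ) + 1)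
  have hA : A.IsLowerTriangular := fun k m hkm ↦
    uFun13_of_le (by exact_mod_cast Nat.succ_le_of_lt (show (k : ℕ) < m from hkm))
  have hdet : A.det ≠ 0 := by
    rw [Matrix.det_of_isLowerTriangular A hA]
    exact Finset.prod_ne_zero_iff.2 fun k _ ↦ (uFun13_pos (lt_add_one _)).ne'
  refine congrFun (Matrix.eq_zero_of_vecMul_eq_zero hdet (funext fun m ↦ ?_))
  simpa [A, Matrix.vecMul, dotProduct, finsetSum_coeff, coeff_phiPolynomial m.isLt] using
    congrArg (fun p : ℝ[X] ↦ p.coeff (2 * (m : ℕ) + 3)) hpoly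

/-- Φ is smooth on ℝ² but admits no global finite separable
decomposition. -/
theorem potential_no_global_decomposition :
    ContDiff ℝ (⊤ : ℕ∞) (fun p : ℝ × ℝ => Phi13 p.1 p.2) ∧
    ¬ ∃ (N : ℕ) (f g : ℝ → Fin N → ℝ),
        ∀ ξ η : ℝ, Phi13 ξ η = ∑ α, f ξ α * g η α := by
  refine ⟨contDiff_Phi13, ?_⟩
  rintro ⟨N, f, g, h⟩
  let T : (Fin N → ℝ) →ₗ[ℝ] (ℝ → ℝ) := LinearMap.pi fun η ↦ Fintype.linearCombination ℝ (g η)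
  have hT : (fun k : Fin (N + 1) ↦ Phi13 ((k : ℝ) + 1)) =
      T ∘ fun k : Fin (N + 1) ↦ f ((k : ℝ) + 1) := by
    ext k η
    simp [T, h, Fintype.linearCombination_apply]
  have hind := linearIndependent_Phi13 (N + 1)
  rw [hT] at hind
  simpa using (hind.of_comp T).fintype_card_le_finrank
end

section
/- Let n ≥ 1 and let c be a nonzero real number. There do not exist an open neighborhood Ω of 0 in ℝⁿ with 1 + 2Σ_{i=1}^n ξᵢηᵢ > 0 for all ξ, η ∈ Ω, a natural number N, and functions u_α, v_α : Ω → ℝ (α = 1,…,N) such that (2/c)·log(1 + 2Σ_{i=1}^n ξᵢηᵢ) = Σ_{α=1}^N u_α(ξ)v_α(η) for all (ξ,η) ∈ Ω × Ω. -/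
/-- Partial fractions with distinct positive parameters are linearly independent on any
interval `(0, r)`. -/
theorem eq_zero_of_sum_div_one_add_mul_eq_zero {ι : Type*} [Fintype ι] {a : ι → ℝ}
    (ha : ∀ j, 0 < a j) (hinj : Function.Injective a) {r : ℝ} (hr : 0 < r) {b : ι → ℝ}
    (h : ∀ y ∈ Set.Ioo 0 r, ∑ j, b j / (1 + a j * y) = 0) (j : ι) : b j = 0 := by
  classical
  let P : Polynomial ℝ := ∑ j, Polynomial.C (b j) *
    ∏ i ∈ Finset.univ.erase j, (1 + Polynomial.C (a i) * Polynomial.X)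
  have hP_eval (y : ℝ) : P.eval y = ∑ j, b j * ∏ i ∈ Finset.univ.erase j, (1 + a i * y) := by
    simp [P, Polynomial.eval_finsetSum, Polynomial.eval_prod]
  have hP : P = 0 := by
    refine Polynomial.eq_zero_of_infinite_isRoot _ ((Set.Ioo_infinite hr).mono fun y hy ↦ ?_)
    have hne (i : ι) : 1 + a i * y ≠ 0 := by
      have := mul_pos (ha i) hy.1
      positivity
    have hmul := congrArg (· * ∏ i, (1 + a i * y)) (h y hy)
    simp only [zero_mul, Finset.sum_mul] at hmul
    rw [Set.mem_ofPred_eq, Polynomial.IsRoot, hP_eval, ← hmul]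
    refine Finset.sum_congr rfl fun k _ ↦ ?_
    rw [← Finset.mul_prod_erase _ _ (Finset.mem_univ k), ← mul_assoc, div_mul_cancel₀ _ (hne k)]
  have hroot := hP_eval (-(a j)⁻¹)
  have haj := (ha j).ne'
  rw [hP, Polynomial.eval_zero, Finset.sum_eq_single j] at hroot
  · refine (mul_eq_zero.mp hroot.symm).resolve_right (Finset.prod_ne_zero_iff.mpr fun i hi hz ↦ ?_)
    refine Finset.ne_of_mem_erase hi (hinj ?_)
    field_simp at hz
    linarith
  · intro k _ hk
    rw [Finset.prod_eq_zero (Finset.mem_erase.mpr ⟨hk.symm, Finset.mem_univ j⟩), mul_zero]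
    field_simp
    ring
  · simp

/-- The functions `y ↦ log (1 + a y)`, for distinct `a > 0`, are linearly independent on any
interval `(0, r)`. -/
theorem eq_zero_of_sum_mul_log_one_add_mul_eq_zero {ι : Type*} [Fintype ι] {a : ι → ℝ}
    (ha : ∀ j, 0 < a j) (hinj : Function.Injective a) {r : ℝ} (hr : 0 < r) {g : ι → ℝ}
    (h : ∀ y ∈ Set.Ioo 0 r, ∑ j, g j * Real.log (1 + a j * y) = 0) (j : ι) : g j = 0 := by
  have hderiv : ∀ y ∈ Set.Ioo 0 r, ∑ j, (g j * a j) / (1 + a j * y) = 0 := by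
    intro y hy
    have hsum : HasDerivAt (fun y ↦ ∑ j, g j * Real.log (1 + a j * y))
        (∑ j, (g j * a j) / (1 + a j * y)) y := by
      refine HasDerivAt.fun_sum fun k _ ↦ ?_
      have hpos : 0 < 1 + a k * y := by
        have := mul_pos (ha k) hy.1
        positivity
      have hlin : HasDerivAt (fun y ↦ 1 + a k * y) (a k) y := by
        simpa using ((hasDerivAt_id y).const_mul (a k)).const_add 1
      simpa [mul_div_assoc] using (hlin.log hpos.ne').const_mul (g k)
    refine hsum.unique ((hasDerivAt_const y (0 : ℝ)).congr_of_eventuallyEq ?_)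
    filter_upwards [isOpen_Ioo.mem_nhds hy] with z hz using h z hz
  exact (mul_eq_zero.mp (eq_zero_of_sum_div_one_add_mul_eq_zero ha hinj hr hderiv j)).resolve_right
    (ha j).ne'

/-- No non-flat para-Kähler space form immerses locally into a flat one:
the function (2/c)·log(1 + 2Σξᵢηᵢ) admits no finite separable decomposition on any
neighborhood of 0. -/
theorem nonflat_into_flat_impossible (n : ℕ) (hn : 1 ≤ n) (c : ℝ) (hc : c ≠ 0) :
    ¬ ∃ (Ω : Set (Fin n → ℝ)) (_ : IsOpen Ω) (_ : (0 : Fin n → ℝ) ∈ Ω)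
        (_ : ∀ ξ ∈ Ω, ∀ η ∈ Ω, (0 : ℝ) < 1 + 2 * ∑ i, ξ i * η i)
        (N : ℕ) (u v : (Fin n → ℝ) → Fin N → ℝ),
      ∀ ξ ∈ Ω, ∀ η ∈ Ω,
        (2 / c) * Real.log (1 + 2 * ∑ i, ξ i * η i) = ∑ α, u ξ α * v η α := by
  rintro ⟨Ω, hΩ, h0, -, N, u, v, h⟩
  obtain ⟨r, hr, hball⟩ := Metric.isOpen_iff.mp hΩ 0 h0
  let e : ℝ → Fin n → ℝ := fun t ↦ Pi.single ⟨0, hn⟩ t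
  have he {t : ℝ} (ht : t ∈ Set.Ioo 0 r) : e t ∈ Ω := by
    refine hball ?_
    rw [mem_ball_zero_iff, Pi.norm_single, Real.norm_eq_abs, abs_of_pos ht.1]
    exact ht.2
  have hdot (s t : ℝ) : ∑ i, e s i * e t i = s * t := by
    simp [e, Pi.single_apply]
  let x : Fin (N + 1) → ℝ := fun j ↦ ((Set.Ioo_infinite hr).natEmbedding _ j : ℝ)
  have hx (j : Fin (N + 1)) : x j ∈ Set.Ioo 0 r := Subtype.property _
  have hx_inj : Function.Injective x := fun i j hij ↦
    Fin.ext (((Set.Ioo_infinite hr).natEmbedding _).injective (Subtype.ext hij))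
  have hdep : ¬ LinearIndependent ℝ fun j ↦ u (e (x j)) := fun hli ↦ by
    simpa using hli.fintype_card_le_finrank
  obtain ⟨g, hg, j, hj⟩ := Fintype.not_linearIndependent_iff.mp hdep
  refine hj (eq_zero_of_sum_mul_log_one_add_mul_eq_zero (a := fun j ↦ 2 * x j)
    (fun j ↦ mul_pos two_pos (hx j).1)
    (fun i j hij ↦ hx_inj (mul_left_cancel₀ two_ne_zero hij)) hr (fun y hy ↦ ?_) j)
  refine (mul_eq_zero.mp ?_).resolve_left (div_ne_zero two_ne_zero hc)
  calc 2 / c * ∑ j, g j * Real.log (1 + 2 * x j * y)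
      = ∑ j, g j * ∑ α, u (e (x j)) α * v (e y) α := by
        rw [Finset.mul_sum]
        refine Finset.sum_congr rfl fun k _ ↦ ?_
        rw [← h _ (he (hx k)) _ (he hy), hdot, mul_assoc 2]
        ring
    _ = ∑ α, (∑ j, g j • u (e (x j))) α * v (e y) α := by
        simp only [Finset.mul_sum, Finset.sum_apply, Finset.sum_mul, Pi.smul_apply, smul_eq_mul,
          mul_assoc]
        exact Finset.sum_comm
    _ = 0 := by rw [hg]; simp
end

section
/- Let n ≥ 1 and let b be a nonzero real number. There do not exist an open neighborhood Ω of 0 in ℝⁿ, a natural number N, and functions u_α, v_α : Ω → ℝ (α = 1,…,N) such that (1/2)·exp((b/2)·Σ_{i=1}^n ξᵢηᵢ) − 1/2 = Σ_{α=1}^N u_α(ξ)v_α(η) for all (ξ,η) ∈ Ω × Ω. -/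
/-- The Vandermonde matrix of distinct nodes does not factor through a smaller index type. -/
lemma vandermonde_ne_mul_of_injective {K : Type*} [Field K] {m k : ℕ} (hk : k < m)
    {w : Fin m → K} (hw : Function.Injective w)
    (A : Matrix (Fin m) (Fin k) K) (B : Matrix (Fin k) (Fin m) K) :
    Matrix.vandermonde w ≠ A * B := by
  intro h
  have hunit : IsUnit (Matrix.vandermonde w) :=
    (Matrix.isUnit_iff_isUnit_det _).2 (Matrix.det_vandermonde_ne_zero_iff.2 hw).isUnit
  have hrank : (Matrix.vandermonde w).rank = m := by
    simpa using Matrix.rank_of_isUnit _ hunit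
  have hle : (Matrix.vandermonde w).rank ≤ k :=
    h ▸ (Matrix.rank_mul_le_left A B).trans (Matrix.rank_le_width A)
  omega

/-- No flat para-Kähler space form immerses locally into a non-flat one:
the function (1/2)·exp((b/2)Σξᵢηᵢ) − 1/2 admits no finite separable decomposition on
any neighborhood of 0. -/
theorem flat_into_nonflat_impossible (n : ℕ) (hn : 1 ≤ n) (b : ℝ) (hb : b ≠ 0) :
    ¬ ∃ (Ω : Set (Fin n → ℝ)) (_ : IsOpen Ω) (_ : (0 : Fin n → ℝ) ∈ Ω)
        (N : ℕ) (u v : (Fin n → ℝ) → Fin N → ℝ),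
      ∀ ξ ∈ Ω, ∀ η ∈ Ω,
        (1 / 2) * Real.exp ((b / 2) * ∑ i, ξ i * η i) - 1 / 2 = ∑ α, u ξ α * v η α := by
  rintro ⟨Ω, hΩ, h0, N, u, v, h⟩
  obtain ⟨ε, hε, hball⟩ := Metric.isOpen_iff.1 hΩ 0 h0
  set s : ℝ := ε / (N + 2) with hs
  have hs0 : 0 < s := by positivity
  let p : Fin (N + 2) → Fin n → ℝ := fun i => Pi.single ⟨0, hn⟩ (i * s)
  have hp : ∀ i, p i ∈ Ω := by
    intro i
    apply hball
    have hi : ((i : ℕ) : ℝ) < N + 2 := by exact_mod_cast i.isLt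
    rw [mem_ball_zero_iff, Pi.norm_single, Real.norm_of_nonneg (by positivity)]
    calc (i : ℝ) * s < (N + 2) * s := by gcongr
      _ = ε := by rw [hs]; field_simp
  have hsum : ∀ i j, ∑ l, p i l * p j l = (i * s) * (j * s) := by
    intro i j
    simp [p, Pi.single_apply]
  let w : Fin (N + 2) → ℝ := fun i => Real.exp (b / 2 * (i * s * s))
  have hw : Function.Injective w := by
    intro i j hij
    have hmul := mul_left_cancel₀ (div_ne_zero hb two_ne_zero) (Real.exp_injective hij)
    have hcast := mul_right_cancel₀ hs0.ne' (mul_right_cancel₀ hs0.ne' hmul)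
    exact Fin.ext (by exact_mod_cast hcast)
  refine vandermonde_ne_mul_of_injective (Nat.lt_succ_self (N + 1)) hw
    (Matrix.of fun i => Fin.cons 1 (u (p i)))
    (Matrix.of fun α j => (Fin.cons 1 fun β => 2 * v (p j) β : Fin (N + 1) → ℝ) α) ?_
  ext i j
  have hij := h _ (hp i) _ (hp j)
  have hpow : w i ^ (j : ℕ) = Real.exp (b / 2 * ((i * s) * (j * s))) := by
    rw [← Real.exp_nat_mul]
    ring_nf
  rw [hsum] at hij
  simp only [Matrix.vandermonde_apply, Matrix.mul_apply, Matrix.of_apply, Fin.sum_univ_succ,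
    Fin.cons_zero, Fin.cons_succ, hpow, mul_left_comm _ (2 : ℝ), ← Finset.mul_sum, ← hij]
  ring
end

section
/- Let n ≥ 1 and let d be a positive integer, and set N = C(n+d, n) − 1 (a binomial coefficient). There exist polynomial maps u, v : ℝⁿ → ℝ^N with u(0) = 0 and v(0) = 0 such that (1/2)·((1 + 2Σ_{i=1}^n ξᵢηᵢ)^d − 1) = Σ_{α=1}^N u_α(ξ)v_α(η) for all ξ, η ∈ ℝⁿ. -/
theorem Multiset.countPerms_replicate {α : Type*} [DecidableEq α] (d : ℕ) (a : α) :
    (Multiset.replicate d a).countPerms = 1 := by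
  have h : (Multiset.replicate d a).filter (a ≠ ·) = 0 :=
    Multiset.filter_eq_nil.2 fun b hb hab => hab (Multiset.eq_of_mem_replicate hb).symm
  rw [Multiset.countPerms_filter_ne a, h, Multiset.countPerms_zero, Multiset.card_replicate,
    Multiset.count_replicate_self, Nat.choose_self]

open MvPolynomial in
/-- The monomial in `X i` obtained from a multiset of indices, `none` contributing the factor `1`. -/
noncomputable def dehomogenizedMonomial {n : ℕ} (m : Multiset (Option (Fin n))) :
    MvPolynomial (Fin n) ℝ :=
  (m.map fun o => o.elim 1 X).prod

theorem eval_dehomogenizedMonomial {n : ℕ} (m : Multiset (Option (Fin n))) (ξ : Fin n → ℝ) :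
    MvPolynomial.eval ξ (dehomogenizedMonomial m) = (m.map fun o => o.elim 1 ξ).prod := by
  rw [dehomogenizedMonomial, map_multiset_prod, Multiset.map_map]
  congr 1
  refine Multiset.map_congr rfl fun o _ => ?_
  cases o <;> simp

theorem eval_zero_dehomogenizedMonomial {n d : ℕ} (k : Sym (Option (Fin n)) d)
    (hk : k ≠ Sym.replicate d none) :
    MvPolynomial.eval 0 (dehomogenizedMonomial (k : Multiset (Option (Fin n)))) = 0 := by
  rw [eval_dehomogenizedMonomial, Multiset.prod_eq_zero_iff, Multiset.mem_map]
  by_contra! h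
  refine hk (Sym.eq_replicate.2 fun o ho => ?_)
  cases o with
  | none => rfl
  | some i => exact absurd rfl (h (some i) ho)

theorem one_add_two_mul_sum_pow {n : ℕ} (d : ℕ) (ξ η : Fin n → ℝ) :
    (1 + 2 * ∑ i, ξ i * η i) ^ d =
      ∑ k : Sym (Option (Fin n)) d, (k : Multiset (Option (Fin n))).countPerms *
        ((k : Multiset (Option (Fin n))).map fun o => o.elim 1 fun _ => (2 : ℝ)).prod *
        (MvPolynomial.eval ξ (dehomogenizedMonomial (k : Multiset (Option (Fin n)))) *
          MvPolynomial.eval η (dehomogenizedMonomial (k : Multiset (Option (Fin n))))) := by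
  have h := Finset.sum_pow (s := Finset.univ)
    (fun o : Option (Fin n) => o.elim (1 : ℝ) fun i => 2 * (ξ i * η i)) d
  simp only [Fintype.sum_option, Option.elim_none, Option.elim_some, ← Finset.mul_sum,
    Finset.sym_univ] at h
  rw [h]
  refine Finset.sum_congr rfl fun k _ => ?_
  rw [eval_dehomogenizedMonomial, eval_dehomogenizedMonomial, mul_assoc,
    ← Multiset.prod_map_mul, ← Multiset.prod_map_mul]
  congr 2
  refine Multiset.map_congr rfl fun o _ => ?_
  cases o <;> simp

theorem card_sym_option_ne_replicate (n d : ℕ) :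
    Fintype.card {k : Sym (Option (Fin n)) d // k ≠ Sym.replicate d none} =
      (n + d).choose n - 1 := by
  rw [Fintype.card_subtype_compl, Fintype.card_subtype_eq, Sym.card_sym_eq_choose,
    Fintype.card_option, Fintype.card_fin, Nat.add_right_comm, Nat.add_sub_cancel,
    Nat.choose_symm_add]

/-- For d ∈ ℤ⁺ and N = C(n+d,n) − 1, the function
(1/2)((1 + 2Σξᵢηᵢ)^d − 1) admits a separable decomposition with N polynomial factors
vanishing at 0. -/
theorem veronese_decomposition_exists (n d : ℕ) (hn : 1 ≤ n) (hd : 1 ≤ d) :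
    ∃ p q : Fin ((n + d).choose n - 1) → MvPolynomial (Fin n) ℝ,
      (∀ α, MvPolynomial.eval (0 : Fin n → ℝ) (p α) = 0) ∧
      (∀ α, MvPolynomial.eval (0 : Fin n → ℝ) (q α) = 0) ∧
      ∀ ξ η : Fin n → ℝ,
        (1 / 2) * ((1 + 2 * ∑ i, ξ i * η i) ^ d - 1)
          = ∑ α, MvPolynomial.eval ξ (p α) * MvPolynomial.eval η (q α) := by
  let e := Fintype.equivFinOfCardEq (card_sym_option_ne_replicate n d)
  let c (k : Sym (Option (Fin n)) d) : ℝ := (k : Multiset (Option (Fin n))).countPerms *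
    ((k : Multiset (Option (Fin n))).map fun o => o.elim 1 fun _ => (2 : ℝ)).prod
  let m (k : Sym (Option (Fin n)) d) := dehomogenizedMonomial (k : Multiset (Option (Fin n)))
  have hm (α) : MvPolynomial.eval 0 (m (e.symm α)) = 0 :=
    eval_zero_dehomogenizedMonomial _ (e.symm α).2
  refine ⟨fun α => MvPolynomial.C (1 / 2 * c (e.symm α)) * m (e.symm α), fun α => m (e.symm α),
    fun α => by rw [map_mul, hm, mul_zero], hm, fun ξ η => ?_⟩
  have hnone : c (Sym.replicate d none) * (MvPolynomial.eval ξ (m (Sym.replicate d none)) *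
      MvPolynomial.eval η (m (Sym.replicate d none))) = 1 := by
    simp [c, m, eval_dehomogenizedMonomial, Sym.coe_replicate, Multiset.countPerms_replicate]
  rw [one_add_two_mul_sum_pow, Fintype.sum_eq_add_sum_subtype_ne _ (Sym.replicate d none),
    hnone, add_sub_cancel_left, Finset.mul_sum,
    e.symm.sum_comp fun k => MvPolynomial.eval ξ (MvPolynomial.C (1 / 2 * c k) * m k) *
      MvPolynomial.eval η (m k)]
  refine Finset.sum_congr rfl fun k _ => ?_
  rw [map_mul, MvPolynomial.eval_C]
  ring
end

section
/- Let n ≥ 1 and let d be a positive integer. For every pair of nonempty open subsets Ω₁, Ω₂ ⊆ ℝⁿ, every natural number M, and all functions f_β : Ω₁ → ℝ, g_β : Ω₂ → ℝ (β = 1,…,M) such that (1/2)·((1 + 2Σ_{i=1}^n ξᵢηᵢ)^d − 1) = Σ_{β=1}^M f_β(ξ)g_β(η) for all (ξ,η) ∈ Ω₁ × Ω₂, one has M ≥ C(n+d, n) − 1. -/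
/-- If `∑ k, c k * u a k * v b k` with all `c k ≠ 0` and the families `u`, `v` linearly independent
has a separable decomposition with `M` terms, then `M` is at least the number of summands. -/
theorem card_le_of_separable_decomposition {A B ι : Type*} [Fintype ι] {M : ℕ}
    (u : A → ι → ℝ) (v : B → ι → ℝ) (c : ι → ℝ) (hc : ∀ k, c k ≠ 0)
    (hu : ∀ w : ι → ℝ, (∀ a, ∑ k, w k * u a k = 0) → w = 0)
    (hv : ∀ w : ι → ℝ, (∀ b, ∑ k, w k * v b k = 0) → w = 0)
    (f : A → Fin M → ℝ) (g : B → Fin M → ℝ)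
    (h : ∀ a b, ∑ k, c k * u a k * v b k = ∑ β, f a β * g b β) :
    Fintype.card ι ≤ M := by
  classical
  let L : (ι → ℝ) →ₗ[ℝ] (B → ℝ) :=
    { toFun := fun w b => ∑ k, c k * w k * v b k
      map_add' := fun x y => by
        ext b; simp only [Pi.add_apply, ← Finset.sum_add_distrib]
        exact Finset.sum_congr rfl fun _ _ => by ring
      map_smul' := fun r x => by
        ext b; simp only [Pi.smul_apply, smul_eq_mul, RingHom.id_apply, Finset.mul_sum]
        exact Finset.sum_congr rfl fun _ _ => by ring }
  let G : (Fin M → ℝ) →ₗ[ℝ] (B → ℝ) :=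
    { toFun := fun w b => ∑ β, w β * g b β
      map_add' := fun x y => by
        ext b; simp only [Pi.add_apply, ← Finset.sum_add_distrib]
        exact Finset.sum_congr rfl fun _ _ => by ring
      map_smul' := fun r x => by
        ext b; simp only [Pi.smul_apply, smul_eq_mul, RingHom.id_apply, Finset.mul_sum]
        exact Finset.sum_congr rfl fun _ _ => by ring }
  have hL : Function.Injective L := by
    rw [injective_iff_map_eq_zero]
    intro w hw
    have hcw := hv (fun k => c k * w k) fun b => congrFun hw b
    ext k
    exact (mul_eq_zero.mp (congrFun hcw k)).resolve_left (hc k)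
  have hspan : Submodule.span ℝ (Set.range u) = ⊤ := by
    by_contra hne
    obtain ⟨φ, hφ, hle⟩ := Submodule.exists_le_ker_of_lt_top _ (lt_top_iff_ne_top.mpr hne)
    have hw := hu (fun k => φ (Pi.single k 1)) fun a => by
      have ha : φ (u a) = 0 := hle (Submodule.subset_span ⟨a, rfl⟩)
      rw [← ha, LinearMap.pi_apply_eq_sum_univ φ (u a)]
      refine Finset.sum_congr rfl fun k _ => ?_
      rw [smul_eq_mul, mul_comm]
      congr 2
      ext j
      simp [Pi.single_apply, eq_comm]
    refine hφ (LinearMap.pi_ext' fun k => LinearMap.ext_ring ?_)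
    simpa using congrFun hw k
  have hrange : LinearMap.range L ≤ LinearMap.range G := by
    rw [LinearMap.range_eq_map, ← hspan, Submodule.map_span_le]
    rintro _ ⟨a, rfl⟩
    exact ⟨f a, funext fun b => (h a b).symm⟩
  calc Fintype.card ι = Module.finrank ℝ (LinearMap.range L) := by
        rw [LinearMap.finrank_range_of_inj hL, Module.finrank_fintype_fun_eq_card]
    _ ≤ Module.finrank ℝ (LinearMap.range G) := Submodule.finrank_mono hrange
    _ ≤ Module.finrank ℝ (Fin M → ℝ) := LinearMap.finrank_range_le G
    _ = M := by simp

/-- A real polynomial vanishing on a nonempty open subset of `ℝⁿ` is zero. -/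
theorem MvPolynomial.eq_zero_of_eval_zero_on_open {n : ℕ} {Ω : Set (Fin n → ℝ)} (hΩ : IsOpen Ω)
    (hne : Ω.Nonempty) (p : MvPolynomial (Fin n) ℝ) (hp : ∀ x ∈ Ω, MvPolynomial.eval x p = 0) :
    p = 0 := by
  obtain ⟨x, hx⟩ := hne
  obtain ⟨ε, hε, hball⟩ := Metric.isOpen_iff.mp hΩ x hx
  refine MvPolynomial.funext_set (fun i => Metric.ball (x i) ε) (fun i => ?_) fun y hy => ?_
  · rw [Real.ball_eq_Ioo]
    exact Set.Ioo_infinite (by linarith)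
  · rw [map_zero]
    exact hp y (hball (by rwa [ball_pi x hε]))

/-- Distinct monomials are linearly independent as functions on a nonempty open set. -/
theorem monomials_linearIndependent_on_open {n : ℕ} {ι : Type*} [Fintype ι]
    {Ω : Set (Fin n → ℝ)} (hΩ : IsOpen Ω) (hne : Ω.Nonempty) (e : ι → Fin n → ℕ)
    (he : Function.Injective e) (w : ι → ℝ)
    (hw : ∀ x : Ω, ∑ k, w k * ∏ i, x.1 i ^ e k i = 0) : w = 0 := by
  classical
  let E : ι → Fin n →₀ ℕ := fun k => Finsupp.equivFunOnFinite.symm (e k)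
  have hE : Function.Injective E := Finsupp.equivFunOnFinite.symm.injective.comp he
  have hp := MvPolynomial.eq_zero_of_eval_zero_on_open hΩ hne
    (∑ k, MvPolynomial.monomial (E k) (w k)) fun x hx => by
      simpa [MvPolynomial.eval_monomial, Finsupp.prod_fintype, E] using hw ⟨x, hx⟩
  ext k
  simpa [MvPolynomial.coeff_sum, MvPolynomial.coeff_monomial, hE.eq_iff] using
    congrArg (MvPolynomial.coeff (E k)) hp

/-- Strong fullness: on any product of nonempty open subsets, every
separable decomposition of (1/2)((1 + 2Σξᵢηᵢ)^d − 1) has at least C(n+d,n) − 1 terms. -/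
theorem veronese_decomposition_minimal (n d : ℕ) (hn : 1 ≤ n) (hd : 1 ≤ d)
    (Ω₁ Ω₂ : Set (Fin n → ℝ)) (h₁ : IsOpen Ω₁) (h₂ : IsOpen Ω₂)
    (hne₁ : Ω₁.Nonempty) (hne₂ : Ω₂.Nonempty)
    (M : ℕ) (f g : (Fin n → ℝ) → Fin M → ℝ)
    (heq : ∀ ξ ∈ Ω₁, ∀ η ∈ Ω₂,
      (1 / 2) * ((1 + 2 * ∑ i, ξ i * η i) ^ d - 1) = ∑ β, f ξ β * g η β) :
    (n + d).choose n - 1 ≤ M := by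
  classical
  let P : Finset (Option (Fin n) → ℕ) := Finset.univ.piAntidiag d
  let K₀ : Option (Fin n) → ℕ := Pi.single none d
  have hK₀ : K₀ ∈ P := by simp [P, K₀, Finset.mem_piAntidiag]
  have hcard : Fintype.card (P.erase K₀) = (n + d).choose n - 1 := by
    rw [Fintype.card_coe, Finset.card_erase_of_mem hK₀,
      show P = Finset.univ.piAntidiag d from rfl, ← Finset.map_sym_eq_piAntidiag,
      Finset.card_map, Finset.sym_univ, Finset.card_univ, Sym.card_sym_eq_choose,
      Fintype.card_option, Fintype.card_fin, Nat.add_right_comm, Nat.add_sub_cancel,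
      Nat.choose_symm_add]
  let e : P.erase K₀ → Fin n → ℕ := fun K i => K.1 (some i)
  have he : Function.Injective e := by
    rintro ⟨K, hK⟩ ⟨K', hK'⟩ hKK'
    have hs : ∀ i, K (some i) = K' (some i) := congrFun hKK'
    have hsum := (Finset.mem_piAntidiag.mp (Finset.mem_of_mem_erase hK)).1
    have hsum' := (Finset.mem_piAntidiag.mp (Finset.mem_of_mem_erase hK')).1
    simp only [Fintype.sum_option, hs] at hsum hsum'
    refine Subtype.ext (funext fun o => ?_)
    cases o with
    | none => change K none = K' none; omega
    | some i => exact hs i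
  let c : (Option (Fin n) → ℕ) → ℝ := fun K =>
    1 / 2 * (Nat.multinomial Finset.univ K * ∏ i, (2 : ℝ) ^ K (some i))
  rw [← hcard]
  refine card_le_of_separable_decomposition (A := Ω₁) (B := Ω₂)
    (fun ξ K => ∏ i, ξ.1 i ^ e K i) (fun η K => ∏ i, η.1 i ^ e K i) (fun K => c K)
    (fun K => ?_) (monomials_linearIndependent_on_open h₁ hne₁ e he)
    (monomials_linearIndependent_on_open h₂ hne₂ e he) (fun ξ => f ξ) (fun η => g η)
    fun ξ η => ?_
  · have hpos : (0 : ℝ) < Nat.multinomial Finset.univ K.1 := by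
      exact_mod_cast Nat.multinomial_pos _ _
    have : 0 < c K := by positivity
    exact this.ne'
  · rw [← heq ξ ξ.2 η η.2]
    have hexp : (1 + 2 * ∑ i, ξ.1 i * η.1 i) ^ d =
        ∑ K ∈ P, (Nat.multinomial Finset.univ K : ℝ) * ∏ i, (2 * (ξ.1 i * η.1 i)) ^ K (some i) := by
      have := Finset.sum_pow_eq_sum_piAntidiag Finset.univ
        (fun o : Option (Fin n) => o.elim (1 : ℝ) fun i => 2 * (ξ.1 i * η.1 i)) d
      simpa [Fintype.sum_option, Fintype.prod_option, Finset.mul_sum] using this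
    have hmul : Nat.multinomial Finset.univ K₀ = 1 := by
      simp [Nat.multinomial, K₀, Fintype.prod_option, Nat.div_self (Nat.factorial_pos d)]
    have hprod : ∏ i, (2 * (ξ.1 i * η.1 i)) ^ K₀ (some i) = 1 := by simp [K₀]
    rw [hexp, ← Finset.add_sum_erase P _ hK₀, hmul, hprod, Nat.cast_one, mul_one,
      add_sub_cancel_left, Finset.mul_sum, ← Finset.sum_coe_sort (P.erase K₀)]
    refine Finset.sum_congr rfl fun K _ => ?_
    simp only [c, e, mul_pow, Finset.prod_mul_distrib]
    ring
end

section
/- Let n, N ≥ 1, let Ω ⊆ ℝⁿ be a nonempty open set, let Ω' ⊆ Ω be dense in Ω, let H : Ω × Ω → ℝ be smooth, let v : Ω → ℝ^N be a function whose image linearly spans ℝ^N, and let u : Ω' → ℝ^N be a function such that H(ξ,η) = Σ_{α=1}^N u_α(ξ)v_α(η) for all (ξ,η) ∈ Ω' × Ω. Then there exists a smooth map ū : Ω → ℝ^N with ū(ξ) = u(ξ) for all ξ ∈ Ω' and H(ξ,η) = Σ_{α=1}^N ū_α(ξ)v_α(η) for all (ξ,η) ∈ Ω × Ω. -/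
/-- Extension lemma (Step 4): a separable decomposition of a smooth H
valid for ξ in a dense subset Ω' extends to all of Ω with a smooth first factor,
provided the second factor v has full linear span. -/
theorem separable_decomposition_extends (n N : ℕ) (hn : 1 ≤ n) (hN : 1 ≤ N)
    (Ω : Set (Fin n → ℝ)) (hΩ : IsOpen Ω) (hne : Ω.Nonempty)
    (Ω' : Set (Fin n → ℝ)) (hsub : Ω' ⊆ Ω) (hdense : Ω ⊆ closure Ω')
    (H : (Fin n → ℝ) → (Fin n → ℝ) → ℝ)
    (hH : ContDiffOn ℝ (⊤ : ℕ∞) (fun p : (Fin n → ℝ) × (Fin n → ℝ) => H p.1 p.2) (Ω ×ˢ Ω))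
    (v : (Fin n → ℝ) → Fin N → ℝ) (hv : Submodule.span ℝ (v '' Ω) = ⊤)
    (u : (Fin n → ℝ) → Fin N → ℝ)
    (heq : ∀ ξ ∈ Ω', ∀ η ∈ Ω, H ξ η = ∑ α, u ξ α * v η α) :
    ∃ ub : (Fin n → ℝ) → Fin N → ℝ,
      ContDiffOn ℝ (⊤ : ℕ∞) ub Ω ∧ (∀ ξ ∈ Ω', ub ξ = u ξ) ∧
      ∀ ξ ∈ Ω, ∀ η ∈ Ω, H ξ η = ∑ α, ub ξ α * v η α := by
  have hsec : ∀ η ∈ Ω, ContDiffOn ℝ (⊤ : ℕ∞) (fun ξ => H ξ η) Ω := fun η hη =>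
    hH.comp (f := fun ξ => (ξ, η)) (contDiff_id.prodMk contDiff_const).contDiffOn
      fun ξ hξ => ⟨hξ, hη⟩
  -- Write each standard basis vector as a finite combination of values of `v` on `Ω`.
  have hrep : ∀ α : Fin N, ∃ l ∈ Finsupp.supported ℝ ℝ Ω,
      Finsupp.linearCombination ℝ v l = Pi.single α 1 := fun α =>
    (Finsupp.mem_span_image_iff_linearCombination ℝ).1 (hv ▸ Submodule.mem_top)
  choose c hc hcv using hrep
  have hmem : ∀ α, ∀ η ∈ (c α).support, η ∈ Ω := fun α η hη =>
    (Finsupp.mem_supported ℝ (c α)).1 (hc α) hη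
  have hsmooth : ContDiffOn ℝ (⊤ : ℕ∞)
      (fun ξ α => ∑ η ∈ (c α).support, c α η * H ξ η) Ω :=
    contDiffOn_pi.2 fun α => ContDiffOn.sum fun η hη =>
      contDiffOn_const.mul (hsec η (hmem α η hη))
  have hagree : ∀ ξ ∈ Ω', (fun α => ∑ η ∈ (c α).support, c α η * H ξ η) = u ξ := by
    intro ξ hξ
    funext α
    have hcoord : ∀ β, ∑ η ∈ (c α).support, c α η * v η β =
        (Pi.single α 1 : Fin N → ℝ) β := fun β => by
      rw [← hcv α, Finsupp.linearCombination_apply, Finsupp.sum, Finset.sum_apply]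
      rfl
    calc ∑ η ∈ (c α).support, c α η * H ξ η
        = ∑ η ∈ (c α).support, ∑ β, u ξ β * (c α η * v η β) :=
          Finset.sum_congr rfl fun η hη => by
            rw [heq ξ hξ η (hmem α η hη), Finset.mul_sum]
            exact Finset.sum_congr rfl fun β _ => by ring
      _ = ∑ β, u ξ β * (Pi.single α 1 : Fin N → ℝ) β := by
          rw [Finset.sum_comm]
          simp_rw [← Finset.mul_sum, hcoord]
      _ = u ξ α := by simp [Pi.single_apply]
  refine ⟨_, hsmooth, hagree, fun ξ hξ η hη => ?_⟩
  refine Set.EqOn.of_subset_closure (s := Ω') (t := Ω) (f := fun ξ => H ξ η)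
    (g := fun ξ => ∑ α, (∑ η ∈ (c α).support, c α η * H ξ η) * v η α)
    (fun ζ hζ => ?_) (hsec η hη).continuousOn ?_ hsub hdense hξ
  · simp only [heq ζ hζ η hη, ← hagree ζ hζ]
  · exact continuousOn_finsetSum _ fun α _ =>
      (continuousOn_pi.1 hsmooth.continuousOn α).mul continuousOn_const
end
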